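/- arXiv:1501.05033 — 13 statements merged into one kernel-verified Lean document; each statement's English description precedes it below -/
import Mathlib

section
/- Let n ≥ 2, let z_1, …, z_n be pairwise distinct complex numbers, let P be a monic polynomial over ℂ of degree n, and for each j define W_j = P(z_j) / ∏_{k ≠ j} (z_j − z_k). Fix i with P(z_i) ≠ 0 (so W_i ≠ 0). Then P'(z_i)/P(z_i) = Σ_{j ≠ i} 1/(z_i − z_j) + (1 + Σ_{j ≠ i} W_j/(z_i − z_j)) / W_i. -/
open Polynomial Lagrange in
/-- A monic polynomial whose degree is the number of nodes is the nodal polynomial plus the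
Lagrange interpolant of its values. -/
theorem Polynomial.Monic.eq_nodal_add_sum {F ι : Type*} [Field F] [DecidableEq ι] {s : Finset ι}
    {v : ι → F} (hv : Set.InjOn v s) {P : F[X]} (hP : P.Monic) (hdeg : P.natDegree = s.card) :
    P = nodal s v + ∑ j ∈ s,
      C (P.eval (v j) / ∏ k ∈ s.erase j, (v j - v k)) * nodal (s.erase j) v := by
  refine eq_of_degree_sub_lt_of_eval_index_eq s hv ?_ fun i hi => ?_
  · have hPd : P.degree = s.card := by rw [degree_eq_natDegree hP.ne_zero, hdeg]
    rw [← sub_sub]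
    refine (degree_sub_le _ _).trans_lt (max_lt ?_ ?_)
    · rw [← hPd]
      exact degree_sub_lt_left (hPd.trans degree_nodal.symm) hP.ne_zero
        (hP.leadingCoeff.trans (nodal_monic (s := s) (v := v)).leadingCoeff.symm)
    · rw [← mem_degreeLT]
      refine Submodule.sum_mem _ fun j hj => mem_degreeLT.2 ?_
      rw [← smul_eq_C_mul]
      refine (degree_smul_le _ _).trans_lt ?_
      rw [degree_nodal]
      exact_mod_cast Finset.card_erase_lt_of_mem hj
  · have hne : ∏ k ∈ s.erase i, (v i - v k) ≠ 0 := Finset.prod_ne_zero_iff.2 fun k hk =>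
      sub_ne_zero.2 fun h => Finset.ne_of_mem_erase hk (hv hi (Finset.mem_of_mem_erase hk) h).symm
    rw [eval_add, eval_nodal_at_node hi, zero_add, eval_finsetSum,
      Finset.sum_eq_single_of_mem i hi]
    · rw [eval_mul, eval_C, eval_nodal, div_mul_cancel₀ _ hne]
    · intro j _ hji
      rw [eval_mul, eval_nodal_at_node (Finset.mem_erase.2 ⟨hji.symm, hi⟩), mul_zero]

open Polynomial Lagrange in
theorem Lagrange.eval_nodal_erase_of_ne {F ι : Type*} [Field F] [DecidableEq ι] {s : Finset ι}
    {v : ι → F} {j : ι} (hj : j ∈ s) {x : F} (hx : x ≠ v j) :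
    (nodal (s.erase j) v).eval x = (nodal s v).eval x / (x - v j) := by
  rw [nodal_eq_mul_nodal_erase hj, eval_mul, eval_sub, eval_X, eval_C,
    mul_div_cancel_left₀ _ (sub_ne_zero.2 hx)]

/-- For pairwise distinct `z₁, …, zₙ` (`n ≥ 2`), a monic polynomial `P` of
degree `n` with Weierstrass corrections `W_j`, and an index `i` with `P(z_i) ≠ 0` (so
`W_i ≠ 0`), one has
`P'(z_i)/P(z_i) = Σ_{j ≠ i} 1/(z_i − z_j) + (1 + Σ_{j ≠ i} W_j/(z_i − z_j))/W_i`. -/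
theorem log_derivative_weierstrass_identity (n : ℕ) (hn : 2 ≤ n) (z : Fin n → ℂ)
    (hz : Function.Injective z) (P : Polynomial ℂ) (hP : P.Monic) (hdeg : P.natDegree = n)
    (W : Fin n → ℂ)
    (hW : ∀ j, W j = P.eval (z j) / ∏ k ∈ Finset.univ.erase j, (z j - z k))
    (i : Fin n) (hi : P.eval (z i) ≠ 0) :
    W i ≠ 0 ∧
    P.derivative.eval (z i) / P.eval (z i) =
      (∑ j ∈ Finset.univ.erase i, 1 / (z i - z j)) +
      (1 + ∑ j ∈ Finset.univ.erase i, W j / (z i - z j)) / W i := by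
  have hne : ∀ j ∈ Finset.univ.erase i, z i ≠ z j := fun j hj h =>
    Finset.ne_of_mem_erase hj (hz h).symm
  set D := (Lagrange.nodal (Finset.univ.erase i) z).eval (z i) with hD
  have hD0 : D ≠ 0 := Lagrange.eval_nodal_not_at_node hne
  have hWi : W i = P.eval (z i) / D := by rw [hW, hD, Lagrange.eval_nodal]
  have hPi : P.eval (z i) = W i * D := by rw [hWi, div_mul_cancel₀ _ hD0]
  have hWi0 : W i ≠ 0 := hWi ▸ div_ne_zero hi hD0
  refine ⟨hWi0, ?_⟩
  have hPeq := hP.eq_nodal_add_sum (s := Finset.univ) hz.injOn (by simpa using hdeg)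
  simp only [← hW] at hPeq
  have hself : (Lagrange.nodal (Finset.univ.erase i) z).derivative.eval (z i) =
      D * ∑ j ∈ Finset.univ.erase i, 1 / (z i - z j) := by
    rw [Lagrange.derivative_nodal, Polynomial.eval_finsetSum, Finset.mul_sum]
    refine Finset.sum_congr rfl fun j hj => ?_
    rw [Lagrange.eval_nodal_erase_of_ne hj (hne j hj), ← hD, mul_one_div]
  have hother : ∀ j ∈ Finset.univ.erase i,
      (Lagrange.nodal (Finset.univ.erase j) z).derivative.eval (z i) = D / (z i - z j) := by
    intro j hj
    have hij : i ∈ Finset.univ.erase j := by simpa [eq_comm] using hj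
    rw [Lagrange.eval_nodal_derivative_eval_node_eq hij, Finset.erase_right_comm,
      Lagrange.eval_nodal_erase_of_ne hj (hne j hj)]
  have hderiv : P.derivative.eval (z i) = D + (W i * (D * ∑ j ∈ Finset.univ.erase i,
      1 / (z i - z j)) + D * ∑ j ∈ Finset.univ.erase i, W j / (z i - z j)) := by
    rw [hPeq, Polynomial.derivative_add, Polynomial.eval_add,
      Lagrange.eval_nodal_derivative_eval_node_eq (Finset.mem_univ i), Polynomial.derivative_sum,
      Polynomial.eval_finsetSum, ← Finset.add_sum_erase _ _ (Finset.mem_univ i)]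
    simp only [Polynomial.derivative_C_mul, Polynomial.eval_C_mul, hself]
    rw [Finset.mul_sum (f := fun j => W j / (z i - z j))]
    congr 2
    refine Finset.sum_congr rfl fun j hj => ?_
    rw [hother j hj]
    ring
  rw [hderiv, hPi]
  field_simp
  ring
end

section
/- Let n ≥ 2, let z_1, …, z_n be pairwise distinct complex numbers, let P be a monic polynomial over ℂ of degree n, and for each j define W_j = P(z_j) / ∏_{k ≠ j} (z_j − z_k). Fix i and assume P(z_i) ≠ 0, P'(z_i) ≠ 0, and 1 − (P(z_i)/P'(z_i)) · Σ_{j ≠ i} 1/(z_i − z_j) ≠ 0. Then W_i = (P(z_i)/P'(z_i)) · (1 + Σ_{j ≠ i} W_j/(z_i − z_j)) / (1 − (P(z_i)/P'(z_i)) · Σ_{j ≠ i} 1/(z_i − z_j)). -/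
open Polynomial in
/-- A monic polynomial of degree `#s` is the nodal polynomial of `s` plus the Lagrange
interpolant of its values at the nodes. -/
theorem monic_eq_nodal_add_sum {F ι : Type*} [Field F] [DecidableEq ι] {s : Finset ι}
    {v w : ι → F} {P : F[X]} (hv : Set.InjOn v s) (hP : P.Monic) (hdeg : P.natDegree = s.card)
    (hw : ∀ j ∈ s, w j * ∏ k ∈ s.erase j, (v j - v k) = P.eval (v j)) :
    P = Lagrange.nodal s v + ∑ j ∈ s, C (w j) * Lagrange.nodal (s.erase j) v := by
  refine eq_of_degree_sub_lt_of_eval_index_eq s hv ?_ fun i hi => ?_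
  · rw [← sub_sub]
    refine (degree_sub_le _ _).trans_lt (max_lt ?_ ?_)
    · have hPdeg : P.degree = s.card := by rw [degree_eq_natDegree hP.ne_zero, hdeg]
      rw [← hPdeg]
      exact degree_sub_lt_left (by rw [hPdeg, Lagrange.degree_nodal]) hP.ne_zero
        (by rw [hP.leadingCoeff, Lagrange.nodal_monic.leadingCoeff])
    · refine (degree_sum_le _ _).trans_lt ((Finset.sup_lt_iff (WithBot.bot_lt_coe _)).2 ?_)
      intro j hj
      refine (degree_mul_le_of_le degree_C_le le_rfl).trans_lt ?_
      rw [zero_add, Lagrange.degree_nodal]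
      exact_mod_cast Finset.card_erase_lt_of_mem hj
  · rw [eval_add, Lagrange.eval_nodal_at_node hi, zero_add, eval_finsetSum,
      Finset.sum_eq_single_of_mem i hi fun j _ hji => ?_]
    · rw [eval_mul, eval_C, Lagrange.eval_nodal, hw i hi]
    · rw [eval_mul, Lagrange.eval_nodal_at_node (Finset.mem_erase.2 ⟨hji.symm, hi⟩), mul_zero]

open Polynomial in
/-- Derivative at a node of a polynomial written as a nodal polynomial plus a combination of
nodal polynomials with one node removed. -/
theorem eval_derivative_nodal_add_sum {F ι : Type*} [Field F] [DecidableEq ι] {s : Finset ι}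
    {v : ι → F} (w : ι → F) (hv : Set.InjOn v s) {i : ι} (hi : i ∈ s) :
    (Lagrange.nodal s v +
        ∑ j ∈ s, C (w j) * Lagrange.nodal (s.erase j) v).derivative.eval (v i) =
      (∏ k ∈ s.erase i, (v i - v k)) *
        (1 + ∑ j ∈ s.erase i, w j / (v i - v j) + w i * ∑ j ∈ s.erase i, 1 / (v i - v j)) := by
  have herase : ∀ j ∈ s.erase i, (Lagrange.nodal ((s.erase i).erase j) v).eval (v i) =
      (∏ k ∈ s.erase i, (v i - v k)) / (v i - v j) := by
    intro j hj
    have hne : v i - v j ≠ 0 := sub_ne_zero.2 fun h =>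
      Finset.ne_of_mem_erase hj (hv hi (Finset.mem_of_mem_erase hj) h).symm
    rw [eq_div_iff hne, Lagrange.eval_nodal, Finset.prod_erase_mul _ _ hj]
  have hsum : ∑ j ∈ s.erase i, w j * (Lagrange.nodal (s.erase j) v).derivative.eval (v i) =
      (∏ k ∈ s.erase i, (v i - v k)) * ∑ j ∈ s.erase i, w j / (v i - v j) := by
    rw [Finset.mul_sum]
    refine Finset.sum_congr rfl fun j hj => ?_
    rw [Lagrange.eval_nodal_derivative_eval_node_eq
      (Finset.mem_erase.2 ⟨(Finset.ne_of_mem_erase hj).symm, hi⟩), Finset.erase_right_comm,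
      herase j hj]
    ring
  have hself : (Lagrange.nodal (s.erase i) v).derivative.eval (v i) =
      (∏ k ∈ s.erase i, (v i - v k)) * ∑ j ∈ s.erase i, 1 / (v i - v j) := by
    rw [Lagrange.derivative_nodal, eval_finsetSum, Finset.mul_sum]
    refine Finset.sum_congr rfl fun j hj => ?_
    rw [herase j hj, mul_one_div]
  simp only [derivative_add, derivative_sum, derivative_C_mul, eval_add, eval_finsetSum,
    eval_C_mul]
  rw [Lagrange.eval_nodal_derivative_eval_node_eq hi, Lagrange.eval_nodal,
    ← Finset.add_sum_erase _ _ hi, hsum, hself]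
  ring

/-- For pairwise distinct `z₁, …, zₙ` (`n ≥ 2`), a monic polynomial `P` of
degree `n` with Weierstrass corrections `W_j`, and an index `i` with `P(z_i) ≠ 0`,
`P'(z_i) ≠ 0` and `1 − (P(z_i)/P'(z_i))·Σ_{j ≠ i} 1/(z_i − z_j) ≠ 0`, one has
`W_i = (P(z_i)/P'(z_i))·(1 + Σ_{j ≠ i} W_j/(z_i − z_j)) /
       (1 − (P(z_i)/P'(z_i))·Σ_{j ≠ i} 1/(z_i − z_j))`. -/
theorem weierstrass_correction_formula (n : ℕ) (hn : 2 ≤ n) (z : Fin n → ℂ)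
    (hz : Function.Injective z) (P : Polynomial ℂ) (hP : P.Monic) (hdeg : P.natDegree = n)
    (W : Fin n → ℂ)
    (hW : ∀ j, W j = P.eval (z j) / ∏ k ∈ Finset.univ.erase j, (z j - z k))
    (i : Fin n) (hi : P.eval (z i) ≠ 0) (hi' : P.derivative.eval (z i) ≠ 0)
    (hden : 1 - (P.eval (z i) / P.derivative.eval (z i)) *
        (∑ j ∈ Finset.univ.erase i, 1 / (z i - z j)) ≠ 0) :
    W i = (P.eval (z i) / P.derivative.eval (z i)) *
        (1 + ∑ j ∈ Finset.univ.erase i, W j / (z i - z j)) /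
        (1 - (P.eval (z i) / P.derivative.eval (z i)) *
          (∑ j ∈ Finset.univ.erase i, 1 / (z i - z j))) := by
  have hprod : ∀ j, ∏ k ∈ Finset.univ.erase j, (z j - z k) ≠ 0 := fun j =>
    Finset.prod_ne_zero_iff.2 fun k hk =>
      sub_ne_zero.2 fun h => Finset.ne_of_mem_erase hk (hz h).symm
  have hWP : ∀ j, W j * ∏ k ∈ Finset.univ.erase j, (z j - z k) = P.eval (z j) := fun j => by
    rw [hW, div_mul_cancel₀ _ (hprod j)]
  have hrepr := monic_eq_nodal_add_sum (s := Finset.univ) hz.injOn hP (by simpa using hdeg)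
    fun j _ => hWP j
  have hderiv := eval_derivative_nodal_add_sum W hz.injOn (Finset.mem_univ i)
  rw [← hrepr] at hderiv
  rw [eq_div_iff hden]
  have hPi := hWP i
  field_simp
  simp only [one_div] at hderiv ⊢
  rw [hderiv, ← hPi]
  ring
end

section
/- Let n ≥ 2 and let P be a monic polynomial over ℂ of degree n whose roots r_1, …, r_n are pairwise distinct. Then there exist δ > 0 and C > 0 such that: for all pairwise distinct complex numbers z_1, …, z_n with |z_j − r_j| ≤ δ for every j, and every index i, the Weierstrass correction W_i = P(z_i) / ∏_{j ≠ i} (z_i − z_j) satisfies |W_i| ≤ C · max_{1 ≤ j ≤ n} |z_j − r_j|. -/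
/-- An injective finite family in a metric space is uniformly separated. -/
theorem Function.Injective.exists_pos_le_dist {ι α : Type*} [Finite ι] [MetricSpace α]
    {r : ι → α} (hr : Function.Injective r) :
    ∃ d > 0, ∀ i j, i ≠ j → d ≤ dist (r i) (r j) := by
  rcases (Set.range r).subsingleton_or_nontrivial with h | h
  · exact ⟨1, one_pos, fun i j hij => absurd (hr (h ⟨i, rfl⟩ ⟨j, rfl⟩)) hij⟩
  · refine ⟨(Set.range r).infsep, (Set.finite_range r).infsep_pos_iff_nontrivial.2 h,
      fun i j hij => ?_⟩
    exact Set.infsep_le_dist_of_mem ⟨i, rfl⟩ ⟨j, rfl⟩ (hr.ne hij)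

/-- Let `P` be a monic polynomial of degree `n ≥ 2` with pairwise distinct
roots `r₁, …, rₙ`. Then there are `δ > 0` and `C > 0` such that for all pairwise distinct
approximations `z_j` with `|z_j − r_j| ≤ δ`, every Weierstrass correction satisfies
`|W_i| ≤ C · max_j |z_j − r_j|`. -/
theorem weierstrass_correction_order_e (n : ℕ) (hn : 2 ≤ n) (r : Fin n → ℂ)
    (hr : Function.Injective r) (P : Polynomial ℂ)
    (hP : P = ∏ j, (Polynomial.X - Polynomial.C (r j))) :
    ∃ δ > 0, ∃ C > 0, ∀ z : Fin n → ℂ, Function.Injective z →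
      (∀ j, ‖z j - r j‖ ≤ δ) → ∀ i : Fin n,
      ‖P.eval (z i) / ∏ j ∈ Finset.univ.erase i, (z i - z j)‖ ≤
        C * (⨆ j, ‖z j - r j‖) := by
  obtain ⟨d, hd, hsep⟩ := hr.exists_pos_le_dist
  refine ⟨d / 3, by positivity, 2 ^ (n - 1), by positivity, fun z hz hclose i => ?_⟩
  have hfactor : ∀ j ∈ Finset.univ.erase i, ‖(z i - r j) / (z i - z j)‖ ≤ 2 := by
    intro j hj
    have hij : i ≠ j := (Finset.ne_of_mem_erase hj).symm
    have hpos : 0 < ‖z i - z j‖ := norm_pos_iff.2 (sub_ne_zero.2 (hz.ne hij))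
    have hrij := hsep i j hij
    have h₁ : dist (r i) (r j) ≤ ‖z i - r i‖ + ‖z i - z j‖ + ‖z j - r j‖ := by
      have := dist_triangle4 (r i) (z i) (z j) (r j)
      rwa [dist_comm (r i) (z i), dist_eq_norm (z i), dist_eq_norm (z i), dist_eq_norm (z j)]
        at this
    have h₂ : ‖z i - r j‖ ≤ ‖z i - z j‖ + ‖z j - r j‖ := norm_sub_le_norm_sub_add_norm_sub ..
    rw [norm_div, div_le_iff₀ hpos]
    linarith [hclose i, hclose j]
  have hprod : ‖∏ j ∈ Finset.univ.erase i, (z i - r j) / (z i - z j)‖ ≤ 2 ^ (n - 1) := by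
    rw [norm_prod]
    refine (Finset.prod_le_prod (fun _ _ => norm_nonneg _) hfactor).trans ?_
    simp [Finset.card_erase_of_mem]
  have hW : P.eval (z i) / ∏ j ∈ Finset.univ.erase i, (z i - z j) =
      (∏ j ∈ Finset.univ.erase i, (z i - r j) / (z i - z j)) * (z i - r i) := by
    rw [hP, Polynomial.eval_prod, Finset.prod_div_distrib,
      ← Finset.mul_prod_erase _ _ (Finset.mem_univ i)]
    simp only [Polynomial.eval_sub, Polynomial.eval_X, Polynomial.eval_C]
    ring
  rw [hW, norm_mul]
  exact mul_le_mul hprod (le_ciSup (f := fun j => ‖z j - r j‖) (Set.finite_range _).bddAbove i)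
    (norm_nonneg _) (by positivity)
end

section
/- Let n ≥ 2 and let P be a monic polynomial over ℂ of degree n whose roots r_1, …, r_n are pairwise distinct. Then there exist δ > 0 and C > 0 such that: for all pairwise distinct complex numbers z_1, …, z_n with 0 < |z_j − r_j| ≤ δ for every j, and every index i, one has P'(z_i) ≠ 0 and the Weierstrass correction W_i = P(z_i) / ∏_{j ≠ i} (z_i − z_j) satisfies |W_i − P(z_i)/P'(z_i)| ≤ C · (max_{1 ≤ j ≤ n} |z_j − r_j|) · |P(z_i)/P'(z_i)|. -/
/-- The derivative of `∏ (X - r j)` at the root `r i` is `∏_{j ≠ i} (r i - r j)`. -/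
theorem eval_derivative_prod_X_sub_C {ι R : Type*} [Fintype ι] [DecidableEq ι] [CommRing R]
    (r : ι → R) (i : ι) :
    (∏ j, (Polynomial.X - Polynomial.C (r j))).derivative.eval (r i) =
      ∏ j ∈ Finset.univ.erase i, (r i - r j) := by
  rw [Polynomial.derivative_prod_finset, Polynomial.eval_finsetSum, Finset.sum_eq_single i]
  · simp [Polynomial.eval_prod]
  · intro b _ hb
    rw [Polynomial.eval_mul, Polynomial.eval_prod,
      Finset.prod_eq_zero (Finset.mem_erase.2 ⟨hb.symm, Finset.mem_univ i⟩) (by simp), zero_mul]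
  · simp

theorem prod_erase_sub_ne_zero {ι R : Type*} [Fintype ι] [DecidableEq ι] [CommRing R]
    [IsDomain R] {z : ι → R} (hz : Function.Injective z) (i : ι) :
    ∏ j ∈ Finset.univ.erase i, (z i - z j) ≠ 0 :=
  Finset.prod_ne_zero_iff.2 fun _ hj => sub_ne_zero.2 (hz.ne (Finset.ne_of_mem_erase hj).symm)


/-- Let `P` be a monic polynomial of degree `n ≥ 2` with pairwise distinct
roots `r₁, …, rₙ`. Then there are `δ > 0` and `C > 0` such that for all pairwise distinct
approximations `z_j` with `0 < |z_j − r_j| ≤ δ` and every index `i`, one has `P'(z_i) ≠ 0`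
and `|W_i − P(z_i)/P'(z_i)| ≤ C · (max_j |z_j − r_j|) · |P(z_i)/P'(z_i)|`. -/
theorem weierstrass_correction_vs_newton (n : ℕ) (hn : 2 ≤ n) (r : Fin n → ℂ)
    (hr : Function.Injective r) (P : Polynomial ℂ)
    (hP : P = ∏ j, (Polynomial.X - Polynomial.C (r j))) :
    ∃ δ > 0, ∃ C > 0, ∀ z : Fin n → ℂ, Function.Injective z →
      (∀ j, 0 < ‖z j - r j‖ ∧ ‖z j - r j‖ ≤ δ) → ∀ i : Fin n,
      P.derivative.eval (z i) ≠ 0 ∧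
      ‖(P.eval (z i) / ∏ j ∈ Finset.univ.erase i, (z i - z j)) -
          P.eval (z i) / P.derivative.eval (z i)‖ ≤
        C * (⨆ j, ‖z j - r j‖) * ‖P.eval (z i) / P.derivative.eval (z i)‖ := by
  have hPr : ∀ i, P.derivative.eval (r i) = ∏ j ∈ Finset.univ.erase i, (r i - r j) := fun i => by
    rw [hP, eval_derivative_prod_X_sub_C]
  let F : Fin n → (Fin n → ℂ) → ℂ := fun i z =>
    P.derivative.eval (z i) / ∏ j ∈ Finset.univ.erase i, (z i - z j)
  have hFr : ∀ i, F i r = 1 := fun i => by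
    simp only [F, hPr, div_self (prod_erase_sub_ne_zero hr i)]
  have hpoly : ∀ i, Differentiable ℂ fun z : Fin n → ℂ => P.derivative.eval (z i) := fun i =>
    P.derivative.differentiable.comp (differentiable_apply i)
  have hF : ∀ i, DifferentiableAt ℂ (F i) r := fun i => by
    simp only [F, div_eq_mul_inv]
    refine (hpoly i r).mul (DifferentiableAt.fun_inv ?_ (prod_erase_sub_ne_zero hr i))
    fun_prop
  choose c hc hFc using fun i => (hF i).isBigO_sub.exists_pos
  have hev : ∀ᶠ z in nhds r, ∀ i, P.derivative.eval (z i) ≠ 0 ∧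
      ‖F i z - F i r‖ ≤ c i * ‖z - r‖ :=
    Filter.eventually_all.2 fun i =>
      ((hpoly i).continuous.continuousAt.eventually_ne
        (by rw [hPr]; exact prod_erase_sub_ne_zero hr i)).and (hFc i).bound
  obtain ⟨δ, hδ, hball⟩ := Metric.nhds_basis_closedBall.eventually_iff.1 hev
  refine ⟨δ, hδ, ∑ i, c i, Finset.sum_pos (fun i _ => hc i) ⟨⟨0, by omega⟩, Finset.mem_univ _⟩,
    fun z hz hzr i => ?_⟩
  have hmem : z ∈ Metric.closedBall r δ := by
    rw [mem_closedBall_iff_norm, pi_norm_le_iff_of_nonneg hδ.le]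
    exact fun j => (hzr j).2
  obtain ⟨hne, hle⟩ := hball hmem i
  refine ⟨hne, ?_⟩
  have hnorm : ‖z - r‖ ≤ ⨆ j, ‖z j - r j‖ :=
    (pi_norm_le_iff_of_nonneg (Real.iSup_nonneg fun j => norm_nonneg _)).2 fun j =>
      le_ciSup (f := fun j => ‖z j - r j‖) (Set.finite_range _).bddAbove j
  have hsplit : P.eval (z i) / ∏ j ∈ Finset.univ.erase i, (z i - z j) -
      P.eval (z i) / P.derivative.eval (z i) =
      (F i z - F i r) * (P.eval (z i) / P.derivative.eval (z i)) := by
    have hQ := prod_erase_sub_ne_zero hz i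
    rw [hFr]
    simp only [F]
    field_simp
  rw [hsplit, norm_mul]
  gcongr
  refine hle.trans ?_
  gcongr
  · exact Finset.sum_nonneg fun j _ => (hc j).le
  · exact Finset.single_le_sum (fun j _ => (hc j).le) (Finset.mem_univ i)
end

section
/- (Lemma 1) Let P be a polynomial over ℂ and let r be a simple root of P, i.e., P(r) = 0 and P'(r) ≠ 0. Then there exist δ > 0 and C > 0 such that for every complex number z with |z − r| ≤ δ, one has P'(z) ≠ 0 and, for all complex numbers a and b, |(P(z)/P'(z)) · ((P''(z)·P(z)/(2·P'(z)²))·a + b)| ≤ C · |z − r| · (|z − r|·|a| + |b|). In particular, if |a| ≤ K·ε and |b| ≤ K·ε² with |z − r| ≤ ε ≤ δ, then the left-hand side is at most C·K·2·ε³, i.e., the expression is O(e³) where e is the error. -/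
/-- **Lemma 1.** Let `r` be a simple root of a polynomial `P` over `ℂ`. Then
there are `δ > 0` and `C > 0` such that for `|z − r| ≤ δ` one has `P'(z) ≠ 0` and, for all
`a b : ℂ`,
`|(P(z)/P'(z)) · ((P''(z)P(z)/(2P'(z)²))·a + b)| ≤ C·|z − r|·(|z − r|·|a| + |b|)`;
in particular, if `|a| ≤ K·ε` and `|b| ≤ K·ε²` with `|z − r| ≤ ε ≤ δ`, the left-hand side
is at most `C·K·2·ε³`. -/
theorem lemma1_cubic_remainder (P : Polynomial ℂ) (r : ℂ) (hr : P.eval r = 0)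
    (hr' : P.derivative.eval r ≠ 0) :
    ∃ δ > 0, ∃ C > 0, ∀ z : ℂ, ‖z - r‖ ≤ δ →
      P.derivative.eval z ≠ 0 ∧
      (∀ a b : ℂ,
        ‖P.eval z / P.derivative.eval z *
            ((P.derivative.derivative.eval z * P.eval z /
              (2 * (P.derivative.eval z) ^ 2)) * a + b)‖ ≤
          C * ‖z - r‖ * (‖z - r‖ * ‖a‖ + ‖b‖)) ∧
      (∀ a b : ℂ, ∀ K ε : ℝ, ‖z - r‖ ≤ ε → ε ≤ δ → ‖a‖ ≤ K * ε → ‖b‖ ≤ K * ε ^ 2 →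
        ‖P.eval z / P.derivative.eval z *
            ((P.derivative.derivative.eval z * P.eval z /
              (2 * (P.derivative.eval z) ^ 2)) * a + b)‖ ≤
          C * K * 2 * ε ^ 3) := by
  obtain ⟨Q, hQ⟩ := Polynomial.dvd_iff_isRoot.mpr hr
  have hPQ (z : ℂ) : P.eval z = (z - r) * Q.eval z := by
    conv_lhs => rw [hQ]
    simp
  set g : ℂ → ℂ := fun z => Q.eval z / P.derivative.eval z with hg
  set h : ℂ → ℂ := fun z =>
    P.derivative.derivative.eval z * Q.eval z / (2 * (P.derivative.eval z) ^ 2) with hh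
  have hgc : ContinuousAt g r :=
    Q.continuous.continuousAt.div P.derivative.continuous.continuousAt hr'
  have hhc : ContinuousAt h r :=
    (P.derivative.derivative.continuous.mul Q.continuous).continuousAt.div
      (continuous_const.mul (P.derivative.continuous.pow 2)).continuousAt (by simpa using hr')
  have hev : ∀ᶠ z in nhds r, P.derivative.eval z ≠ 0 ∧ ‖g z‖ < ‖g r‖ + 1 ∧ ‖h z‖ < ‖h r‖ + 1 :=
    (P.derivative.continuous.continuousAt.eventually_ne hr').and
      ((hgc.norm.eventually_lt_const (lt_add_one _)).and
        (hhc.norm.eventually_lt_const (lt_add_one _)))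
  obtain ⟨δ, hδ, hball⟩ := Metric.nhds_basis_closedBall.eventually_iff.mp hev
  have hbound (z : ℂ) (hz : ‖z - r‖ ≤ δ) (a b : ℂ) :
      ‖P.eval z / P.derivative.eval z *
          ((P.derivative.derivative.eval z * P.eval z /
            (2 * (P.derivative.eval z) ^ 2)) * a + b)‖ ≤
        (‖g r‖ + 1) * (‖h r‖ + 1) * ‖z - r‖ * (‖z - r‖ * ‖a‖ + ‖b‖) := by
    obtain ⟨-, hgz, hhz⟩ := hball (mem_closedBall_iff_norm.mpr hz)
    have hfactor : P.eval z / P.derivative.eval z *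
          ((P.derivative.derivative.eval z * P.eval z /
            (2 * (P.derivative.eval z) ^ 2)) * a + b) =
        (z - r) * g z * ((z - r) * h z * a + b) := by
      simp only [hg, hh, hPQ]
      ring
    calc _ = ‖z - r‖ * ‖g z‖ * ‖(z - r) * h z * a + b‖ := by rw [hfactor, norm_mul, norm_mul]
      _ ≤ ‖z - r‖ * ‖g z‖ * (‖z - r‖ * ‖h z‖ * ‖a‖ + ‖b‖) := by
        gcongr
        exact (norm_add_le _ _).trans_eq (by rw [norm_mul, norm_mul])
      _ ≤ ‖z - r‖ * (‖g r‖ + 1) * (‖z - r‖ * (‖h r‖ + 1) * ‖a‖ + (‖h r‖ + 1) * ‖b‖) := by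
        gcongr
        exact le_mul_of_one_le_left (norm_nonneg b) (le_add_of_nonneg_left (norm_nonneg _))
      _ = _ := by ring
  refine ⟨δ, hδ, (‖g r‖ + 1) * (‖h r‖ + 1), by positivity, fun z hz =>
    ⟨(hball (mem_closedBall_iff_norm.mpr hz)).1, hbound z hz, fun a b K ε hε _ ha hb => ?_⟩⟩
  have hε0 : 0 ≤ ε := (norm_nonneg _).trans hε
  calc _ ≤ _ := hbound z hz a b
    _ ≤ (‖g r‖ + 1) * (‖h r‖ + 1) * ε * (ε * (K * ε) + K * ε ^ 2) := by gcongr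
    _ = _ := by ring
end

section
/- Let P be a polynomial over ℂ and let r be a simple root of P, i.e., P(r) = 0 and P'(r) ≠ 0. Then the Chebyshev iteration is of cubic order at r: there exist δ > 0 and C > 0 such that for every complex z with |z − r| ≤ δ, one has P'(z) ≠ 0 and |z − P(z)/P'(z) − P''(z)·P(z)²/(2·P'(z)³) − r| ≤ C · |z − r|³. -/
/-- The error of one Chebyshev step for `P = (X - r) * Q`, as a multiple of `(z - r) ^ 3`. -/
theorem chebyshev_error_eq {P Q : Polynomial ℂ} {r z : ℂ}
    (hQ : P = (Polynomial.X - Polynomial.C r) * Q) (hz : P.derivative.eval z ≠ 0) :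
    z - P.eval z / P.derivative.eval z -
        P.derivative.derivative.eval z * (P.eval z) ^ 2 / (2 * (P.derivative.eval z) ^ 3) - r =
      (4 * Q.eval z * Q.derivative.eval z ^ 2 + 2 * (z - r) * Q.derivative.eval z ^ 3 -
          Q.eval z ^ 2 * Q.derivative.derivative.eval z) / (2 * (P.derivative.eval z) ^ 3) *
        (z - r) ^ 3 := by
  have h₀ : P.eval z = (z - r) * Q.eval z := by simp [hQ]
  have h₁ : P.derivative.eval z = Q.eval z + (z - r) * Q.derivative.eval z := by
    simp [hQ, Polynomial.derivative_mul]
  have h₂ : P.derivative.derivative.eval z =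
      2 * Q.derivative.eval z + (z - r) * Q.derivative.derivative.eval z := by
    simp [hQ, Polynomial.derivative_mul]
    ring
  rw [h₁] at hz
  rw [h₀, h₁, h₂]
  field_simp
  ring

/-- Let `r` be a simple root of a polynomial `P` over `ℂ`. Then the
Chebyshev iteration `z ↦ z − P(z)/P'(z) − P''(z)P(z)²/(2P'(z)³)` is of cubic order at `r`. -/
theorem chebyshev_cubic_order (P : Polynomial ℂ) (r : ℂ) (hr : P.eval r = 0)
    (hr' : P.derivative.eval r ≠ 0) :
    ∃ δ > 0, ∃ C > 0, ∀ z : ℂ, ‖z - r‖ ≤ δ →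
      P.derivative.eval z ≠ 0 ∧
      ‖z - P.eval z / P.derivative.eval z -
          P.derivative.derivative.eval z * (P.eval z) ^ 2 /
            (2 * (P.derivative.eval z) ^ 3) - r‖ ≤ C * ‖z - r‖ ^ 3 := by
  obtain ⟨Q, hQ⟩ := Polynomial.dvd_iff_isRoot.mpr hr
  let g : ℂ → ℂ := fun z =>
    (4 * Q.eval z * Q.derivative.eval z ^ 2 + 2 * (z - r) * Q.derivative.eval z ^ 3 -
      Q.eval z ^ 2 * Q.derivative.derivative.eval z) / (2 * (P.derivative.eval z) ^ 3)
  have hg : ContinuousAt g r :=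
    ContinuousAt.div (by fun_prop) (by fun_prop) (by simpa using hr')
  have hbound : ∀ᶠ z in nhds r, ‖g z‖ < ‖g r‖ + 1 :=
    hg.norm.eventually_lt continuousAt_const (lt_add_one _)
  have hne : ∀ᶠ z in nhds r, P.derivative.eval z ≠ 0 :=
    P.derivative.continuous.continuousAt.eventually_ne hr'
  obtain ⟨δ, hδ, hball⟩ := Metric.nhds_basis_closedBall.eventually_iff.mp (hne.and hbound)
  refine ⟨δ, hδ, ‖g r‖ + 1, by positivity, fun z hz => ?_⟩
  obtain ⟨hz', hgz⟩ := hball (mem_closedBall_iff_norm.mpr hz)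
  refine ⟨hz', ?_⟩
  rw [chebyshev_error_eq hQ hz', norm_mul, norm_pow]
  gcongr
end

section
/- (Theorem 1: Weierstrass-like trapezoidal Newton's method is of cubic order) Let n ≥ 2 and let P be a monic polynomial over ℂ of degree n whose roots r_1, …, r_n are pairwise distinct. Then there exist δ > 0 and C > 0 such that: for all pairwise distinct complex numbers z_1, …, z_n with |z_j − r_j| ≤ δ for every j, and every index i, setting W_i = P(z_i) / ∏_{j ≠ i} (z_i − z_j), one has P'(z_i) + P'(z_i − W_i) ≠ 0 and the new approximation ẑ_i = z_i − 2·P(z_i)/(P'(z_i) + P'(z_i − W_i)) satisfies |ẑ_i − r_i| ≤ C · (max_{1 ≤ j ≤ n} |z_j − r_j|)³. -/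
open Polynomial Filter Topology

/-- The error of a trapezoidal Newton step at `x`, with corrected point `y`, for the polynomial
`(X - a) * Q`, where `S` is the divided difference of `Q` at `a`. -/
theorem trapezoidal_step_error {P Q S : ℂ[X]} {a x y g : ℂ} (hP : P = (X - C a) * Q)
    (hS : Q - C (Q.eval a) = (X - C a) * S) (hy : y - a = (x - a) * (1 - g))
    (hD : P.derivative.eval x + P.derivative.eval y ≠ 0) :
    x - 2 * P.eval x / (P.derivative.eval x + P.derivative.eval y) - a =
      (x - a) ^ 2 * (((x - a) * S.derivative.eval x + (1 - g) * (S.eval y + Q.derivative.eval y)) /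
        (P.derivative.eval x + P.derivative.eval y)) := by
  have hQ : Q = (X - C a) * S + C (Q.eval a) := by rw [← hS]; ring
  have hQe (t : ℂ) : Q.eval t = (t - a) * S.eval t + Q.eval a := by
    simpa using congrArg (eval t) hQ
  have hQd (t : ℂ) : Q.derivative.eval t = S.eval t + (t - a) * S.derivative.eval t := by
    simpa using congrArg (fun R : ℂ[X] => R.derivative.eval t) hQ
  have hPe : P.eval x = (x - a) * Q.eval x := by simp [hP]
  have hPd (t : ℂ) : P.derivative.eval t = Q.eval t + (t - a) * Q.derivative.eval t := by
    simp [hP]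
  have key : (x - a) * (P.derivative.eval x + P.derivative.eval y) - 2 * P.eval x =
      (x - a) ^ 2 *
        ((x - a) * S.derivative.eval x + (1 - g) * (S.eval y + Q.derivative.eval y)) := by
    rw [hPe, hPd, hPd, hQe x, hQe y, hQd x]
    linear_combination (x - a) * (S.eval y + Q.derivative.eval y) * hy
  rw [← mul_div_assoc, ← key]
  field_simp
  ring

theorem Polynomial.differentiableAt_eval_comp {E : Type*} [NormedAddCommGroup E] [NormedSpace ℂ E]
    (p : ℂ[X]) {f : E → ℂ} {x : E} (hf : DifferentiableAt ℂ f x) :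
    DifferentiableAt ℂ (fun z => p.eval (f z)) x :=
  DifferentiableAt.comp x p.differentiableAt hf

/-- Cubic convergence of the Weierstrass-like trapezoidal Newton step in one coordinate. -/
theorem eventually_weierstrass_trapezoidal_cubic {ι : Type*} [Fintype ι] [DecidableEq ι]
    {r : ι → ℂ} (hr : Function.Injective r) {P : ℂ[X]} (hP : P = ∏ j, (X - C (r j))) (i : ι) :
    ∃ K > 0, ∀ᶠ z in 𝓝 r, ∀ W, W = P.eval (z i) / ∏ j ∈ Finset.univ.erase i, (z i - z j) →
      P.derivative.eval (z i) + P.derivative.eval (z i - W) ≠ 0 ∧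
      ‖z i - 2 * P.eval (z i) /
        (P.derivative.eval (z i) + P.derivative.eval (z i - W)) - r i‖ ≤ K * ‖z - r‖ ^ 3 := by
  set Q : ℂ[X] := ∏ j ∈ Finset.univ.erase i, (X - C (r j)) with hQ
  have hPQ : P = (X - C (r i)) * Q := by
    rw [hP, hQ, Finset.mul_prod_erase _ (fun j => X - C (r j)) (Finset.mem_univ i)]
  obtain ⟨S, hS⟩ : X - C (r i) ∣ Q - C (Q.eval (r i)) := X_sub_C_dvd_sub_C_eval
  have hprod : Q.eval (r i) = ∏ j ∈ Finset.univ.erase i, (r i - r j) := by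
    simp [hQ, eval_prod]
  have hQr : Q.eval (r i) ≠ 0 := by
    rw [hprod, Finset.prod_ne_zero_iff]
    intro j hj
    exact sub_ne_zero.2 fun h => (Finset.ne_of_mem_erase hj) (hr h).symm
  have hcoord (j : ι) : DifferentiableAt ℂ (fun z : ι → ℂ => z j) r := by fun_prop
  let g : (ι → ℂ) → ℂ := fun z => Q.eval (z i) / ∏ j ∈ Finset.univ.erase i, (z i - z j)
  let y : (ι → ℂ) → ℂ := fun z => z i - (z i - r i) * g z
  let D : (ι → ℂ) → ℂ := fun z => P.derivative.eval (z i) + P.derivative.eval (y z)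
  let F : (ι → ℂ) → ℂ := fun z =>
    ((z i - r i) * S.derivative.eval (z i) +
      (1 - g z) * (S.eval (y z) + Q.derivative.eval (y z))) / D z
  have hgr : g r = 1 := by simp only [g, ← hprod, div_self hQr]
  have hyr : y r = r i := by simp [y]
  have hDr : D r ≠ 0 := by
    simp only [D, hyr, hPQ]
    simpa [← two_mul] using hQr
  have hg : DifferentiableAt ℂ g r := by
    simp only [g, div_eq_mul_inv]
    refine (Q.differentiableAt_eval_comp (hcoord i)).fun_mul (.fun_inv ?_ (hprod ▸ hQr))
    fun_prop
  have hy : DifferentiableAt ℂ y r := by fun_prop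
  have hD : DifferentiableAt ℂ D r :=
    (P.derivative.differentiableAt_eval_comp (hcoord i)).add
      (P.derivative.differentiableAt_eval_comp hy)
  have hF : DifferentiableAt ℂ F r := by
    simp only [F, div_eq_mul_inv]
    refine .fun_mul (.fun_add (.fun_mul ?_ ?_) (.fun_mul ?_ (.fun_add ?_ ?_))) (hD.fun_inv hDr)
    · fun_prop
    · exact S.derivative.differentiableAt_eval_comp (hcoord i)
    · fun_prop
    · exact S.differentiableAt_eval_comp hy
    · exact Q.derivative.differentiableAt_eval_comp hy
  have hFr : F r = 0 := by simp [F, hgr]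
  obtain ⟨K, hK, hFK⟩ := hF.isBigO_sub.exists_pos
  refine ⟨K, hK, ?_⟩
  filter_upwards [hFK.bound, hD.continuousAt.eventually_ne hDr] with z hFz hDz W hW
  have hWy : z i - W = y z := by
    simp [hW, hPQ, y, g, mul_div_assoc]
  rw [hWy]
  refine ⟨hDz, ?_⟩
  rw [trapezoidal_step_error hPQ hS (show y z - r i = (z i - r i) * (1 - g z) by ring) hDz]
  rw [hFr, sub_zero] at hFz
  calc ‖(z i - r i) ^ 2 * F z‖ = ‖(z - r) i‖ ^ 2 * ‖F z‖ := by simp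
    _ ≤ ‖z - r‖ ^ 2 * (K * ‖z - r‖) := by
      gcongr
      exact norm_le_pi_norm (z - r) i
    _ = K * ‖z - r‖ ^ 3 := by ring


/-- **Theorem 1.** The Weierstrass-like trapezoidal Newton method
`ẑ_i = z_i − 2P(z_i)/(P'(z_i) + P'(z_i − W_i))` is of cubic order: for a monic `P` of degree
`n ≥ 2` with pairwise distinct roots `r_j`, there are `δ > 0` and `C > 0` such that for
pairwise distinct `z_j` with `|z_j − r_j| ≤ δ`, the denominator is nonzero and
`|ẑ_i − r_i| ≤ C · (max_j |z_j − r_j|)³`. -/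
theorem method1_cubic_order (n : ℕ) (hn : 2 ≤ n) (r : Fin n → ℂ)
    (hr : Function.Injective r) (P : Polynomial ℂ)
    (hP : P = ∏ j, (Polynomial.X - Polynomial.C (r j))) :
    ∃ δ > 0, ∃ C > 0, ∀ z : Fin n → ℂ, Function.Injective z →
      (∀ j, ‖z j - r j‖ ≤ δ) → ∀ i : Fin n, ∀ Wi : ℂ,
      Wi = P.eval (z i) / ∏ j ∈ Finset.univ.erase i, (z i - z j) →
      P.derivative.eval (z i) + P.derivative.eval (z i - Wi) ≠ 0 ∧
      ‖z i - 2 * P.eval (z i) /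
          (P.derivative.eval (z i) + P.derivative.eval (z i - Wi)) - r i‖ ≤
        C * (⨆ j, ‖z j - r j‖) ^ 3 := by
  choose K hK hev using eventually_weierstrass_trapezoidal_cubic hr hP
  obtain ⟨ε, hε, hball⟩ := Metric.eventually_nhds_iff.1 (eventually_all.2 hev)
  have : Nonempty (Fin n) := ⟨⟨0, by omega⟩⟩
  refine ⟨ε / 2, half_pos hε, ∑ i, K i,
    Finset.sum_pos (fun i _ => hK i) Finset.univ_nonempty, fun z _ hz i W hW => ?_⟩
  have hzr : ‖z - r‖ ≤ ε / 2 := (pi_norm_le_iff_of_nonneg (half_pos hε).le).2 hz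
  have hsup : ‖z - r‖ ≤ ⨆ j, ‖z j - r j‖ :=
    (pi_norm_le_iff_of_nonneg (Real.iSup_nonneg fun _ => norm_nonneg _)).2 fun j =>
      le_ciSup (f := fun j => ‖z j - r j‖) (Set.finite_range _).bddAbove j
  obtain ⟨hD, hle⟩ := hball (by rw [dist_eq_norm]; linarith) i W hW
  refine ⟨hD, hle.trans ?_⟩
  have hKi : K i ≤ ∑ i, K i :=
    Finset.single_le_sum (fun j _ => (hK j).le) (Finset.mem_univ i)
  have := (hK i).le.trans hKi
  gcongr
end

section
/- (Theorem 2: Derivative-free trapezoidal Newton's method is of cubic order) Let n ≥ 2 and let P be a monic polynomial over ℂ of degree n whose roots r_1, …, r_n are pairwise distinct. Then there exist δ > 0 and C > 0 such that: for all pairwise distinct complex numbers z_1, …, z_n with 0 < |z_j − r_j| ≤ δ for every j, and every index i, setting W_i = P(z_i) / ∏_{j ≠ i} (z_i − z_j), one has P(z_i) ≠ 0, 1 − P(z_i − W_i)/P(z_i) ≠ 0, the denominator P'(z_i) + P'(z_i − W_i/(1 − P(z_i − W_i)/P(z_i))) ≠ 0, and the new approximation ẑ_i = z_i − 2·P(z_i)/(P'(z_i)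 + P'(z_i − W_i/(1 − P(z_i − W_i)/P(z_i)))) satisfies |ẑ_i − r_i| ≤ C · (max_{1 ≤ j ≤ n} |z_j − r_j|)³. -/
open Polynomial in
/-- Second-order Taylor expansion of a polynomial with a jointly differentiable remainder. -/
theorem Polynomial.exists_differentiable_taylor_remainder (g : ℂ[X]) :
    ∃ h : ℂ × ℂ → ℂ, Differentiable ℂ h ∧ ∀ x y : ℂ,
      g.eval y = g.eval x + (y - x) * g.derivative.eval x + (y - x) ^ 2 * h (x, y) := by
  induction g using Polynomial.induction_on' with
  | add p q hp hq =>
    obtain ⟨h₁, d₁, e₁⟩ := hp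
    obtain ⟨h₂, d₂, e₂⟩ := hq
    refine ⟨fun t => h₁ t + h₂ t, d₁.add d₂, fun x y => ?_⟩
    simp only [eval_add, derivative_add, e₁ x y, e₂ x y]
    ring
  | monomial k a =>
    induction k with
    | zero => exact ⟨fun _ => 0, differentiable_const _, fun x y => by simp⟩
    | succ k ih =>
      obtain ⟨h, d, e⟩ := ih
      refine ⟨fun t => t.2 * h t + (monomial k a).derivative.eval t.1, ?_, fun x y => ?_⟩
      · exact (differentiable_snd.mul d).add
          ((monomial k a).derivative.differentiable.comp differentiable_fst)
      · rw [← monomial_mul_X]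
        simp only [eval_mul, eval_X, derivative_mul, derivative_X, eval_add, eval_one, e x y]
        ring

open Topology Polynomial in
/-- One step of the derivative-free trapezoidal Newton method near a simple root `a` of
`P = (X - a) * g`, where the current approximation `x` and the denominator `Q` of the correction
depend differentiably on a parameter. -/
theorem exists_cubic_bound_trapezoidal_newton {E : Type*} [NormedAddCommGroup E]
    [NormedSpace ℂ E] (g : ℂ[X]) (a : ℂ) (ha : g.eval a ≠ 0) (x Q : E → ℂ) (r : E)
    (hx : DifferentiableAt ℂ x r) (hQ : DifferentiableAt ℂ Q r) (hxr : x r = a)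
    (hQr : Q r = g.eval a) (P : ℂ[X]) (hP : P = (X - C a) * g) :
    ∃ K > 0, ∀ᶠ z in 𝓝 r, x z ≠ a → ∀ W : ℂ, W = P.eval (x z) / Q z →
      P.eval (x z) ≠ 0 ∧
      1 - P.eval (x z - W) / P.eval (x z) ≠ 0 ∧
      P.derivative.eval (x z) +
        P.derivative.eval (x z - W / (1 - P.eval (x z - W) / P.eval (x z))) ≠ 0 ∧
      ‖x z - 2 * P.eval (x z) /
          (P.derivative.eval (x z) +
            P.derivative.eval (x z - W / (1 - P.eval (x z - W) / P.eval (x z)))) -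
          a‖ ≤ K * ‖z - r‖ ^ 3 := by
  obtain ⟨h, hd, hh⟩ := g.exists_differentiable_taylor_remainder
  have hP' : ∀ y, P.eval y = (y - a) * g.eval y := fun y => by simp [hP]
  have hdP : ∀ y, P.derivative.eval y = g.eval y + (y - a) * g.derivative.eval y :=
    fun y => by simp [hP, derivative_mul]
  have hcomp : ∀ (q : ℂ[X]) {f : E → ℂ}, DifferentiableAt ℂ f r →
      DifferentiableAt ℂ (fun z => q.eval (f z)) r :=
    fun q f hf => q.differentiableAt.comp r hf
  have hdiv : ∀ {f k : E → ℂ}, DifferentiableAt ℂ f r → DifferentiableAt ℂ k r → k r ≠ 0 →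
      DifferentiableAt ℂ (fun z => f z / k z) r := fun hf hk h0 => by
    simpa only [div_eq_mul_inv] using hf.fun_mul (hk.fun_inv h0)
  let α : E → ℂ := fun z => 1 - g.eval (x z) / Q z
  have hα : DifferentiableAt ℂ α r :=
    (hdiv (hcomp g hx) hQ (hQr ▸ ha)).const_sub 1
  have hαr : α r = 0 := by simp [α, hxr, hQr, ha]
  let β : E → ℂ := fun z => α z * g.eval (a + (x z - a) * α z) / g.eval (x z)
  have hβ : DifferentiableAt ℂ β r :=
    hdiv (hα.mul (hcomp g (((hx.sub_const a).mul hα).const_add a))) (hcomp g hx) (by rwa [hxr])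
  have hβr : β r = 0 := by simp [β, hαr]
  let γ : E → ℂ := fun z => 1 - (g.eval (x z) / Q z) / (1 - β z)
  have hγ : DifferentiableAt ℂ γ r :=
    (hdiv (hdiv (hcomp g hx) hQ (hQr ▸ ha)) (hβ.const_sub 1) (by simp [hβr])).const_sub 1
  have hγr : γ r = 0 := by simp [γ, hxr, hQr, ha, hβr]
  let u : E → ℂ := fun z => a + (x z - a) * γ z
  have hu : DifferentiableAt ℂ u r := ((hx.sub_const a).mul hγ).const_add a
  have hur : u r = a := by simp [u, hγr]
  let D : E → ℂ := fun z => P.derivative.eval (x z) + P.derivative.eval (u z)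
  have hD : DifferentiableAt ℂ D r := (hcomp _ hx).add (hcomp _ hu)
  have hDr : D r ≠ 0 := by
    have : D r = 2 * g.eval a := by simp only [D, hdP, hxr, hur]; ring
    rw [this]
    exact mul_ne_zero two_ne_zero ha
  let F : E → ℂ := fun z => (γ z * (g.derivative.eval (x z) + g.derivative.eval (u z)) +
    (x z - a) * (γ z - 1) ^ 2 * h (x z, u z)) / D z
  have hF : DifferentiableAt ℂ F r :=
    hdiv ((hγ.mul ((hcomp _ hx).add (hcomp _ hu))).add
      (((hx.sub_const a).mul ((hγ.sub_const 1).pow 2)).mul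
        ((hd (x r, u r)).comp r (hx.prodMk hu)))) hD hDr
  have hFr : F r = 0 := by simp [F, hγr, hxr]
  have hxO := hx.isBigO_sub.norm_right
  have hO := (hxO.mul hxO).mul hF.isBigO_sub.norm_right
  obtain ⟨K, hK, hO⟩ := hO.exists_pos
  refine ⟨K, hK, ?_⟩
  filter_upwards [hO.bound, hQ.continuousAt.eventually_ne (hQr ▸ ha),
    (hcomp g hx).continuousAt.eventually_ne (by rwa [hxr]),
    hβ.continuousAt.eventually_ne (y := (1 : ℂ)) (by simp [hβr]),
    hD.continuousAt.eventually_ne hDr] with z hz hQz hgz hβz hDz hxz W hW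
  have hxz' : x z - a ≠ 0 := sub_ne_zero.2 hxz
  have hβz' : 1 - β z ≠ 0 := sub_ne_zero.2 (Ne.symm hβz)
  have hW' : x z - W = a + (x z - a) * α z := by
    rw [hW, hP']; simp only [α]; ring
  have hβeq : P.eval (x z - W) / P.eval (x z) = β z := by
    rw [hW', hP', hP']; simp only [β]; field_simp; ring
  have hueq : x z - W / (1 - β z) = u z := by
    rw [hW, hP']; simp only [u, γ]; ring
  rw [hβeq, hueq]
  refine ⟨by rw [hP']; exact mul_ne_zero hxz' hgz, hβz', hDz, ?_⟩
  have key : x z - 2 * P.eval (x z) / (P.derivative.eval (x z) + P.derivative.eval (u z)) - a =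
      (x z - x r) * (x z - x r) * (F z - F r) := by
    have hg := hh (x z) (u z)
    have huz : u z - x z = (x z - a) * (γ z - 1) := by simp only [u]; ring
    rw [huz] at hg
    have hDe : D z = 2 * g.eval (x z) + (x z - a) * (γ z *
        (g.derivative.eval (x z) + g.derivative.eval (u z)) +
        (x z - a) * (γ z - 1) ^ 2 * h (x z, u z)) := by
      have hua : u z - a = (x z - a) * γ z := by simp only [u]; ring
      simp only [D, hdP]
      rw [hua, hg]
      ring
    rw [hFr, hxr, hP', sub_zero]
    change x z - 2 * _ / D z - a = _ * (_ / D z)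
    field_simp
    rw [hDe]
    ring
  rw [key]
  refine hz.trans_eq ?_
  rw [norm_mul, norm_mul, norm_norm]
  ring


/-- **Theorem 2.** The derivative-free trapezoidal Newton method
`ẑ_i = z_i − 2P(z_i)/(P'(z_i) + P'(z_i − W_i/(1 − P(z_i − W_i)/P(z_i))))` is of cubic
order: for a monic `P` of degree `n ≥ 2` with pairwise distinct roots `r_j`, there are
`δ > 0` and `C > 0` such that for pairwise distinct `z_j` with `0 < |z_j − r_j| ≤ δ`, all
denominators are nonzero and `|ẑ_i − r_i| ≤ C · (max_j |z_j − r_j|)³`. -/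
theorem method2_cubic_order (n : ℕ) (hn : 2 ≤ n) (r : Fin n → ℂ)
    (hr : Function.Injective r) (P : Polynomial ℂ)
    (hP : P = ∏ j, (Polynomial.X - Polynomial.C (r j))) :
    ∃ δ > 0, ∃ C > 0, ∀ z : Fin n → ℂ, Function.Injective z →
      (∀ j, 0 < ‖z j - r j‖ ∧ ‖z j - r j‖ ≤ δ) → ∀ i : Fin n, ∀ Wi : ℂ,
      Wi = P.eval (z i) / ∏ j ∈ Finset.univ.erase i, (z i - z j) →
      P.eval (z i) ≠ 0 ∧
      1 - P.eval (z i - Wi) / P.eval (z i) ≠ 0 ∧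
      P.derivative.eval (z i) +
        P.derivative.eval (z i - Wi / (1 - P.eval (z i - Wi) / P.eval (z i))) ≠ 0 ∧
      ‖z i - 2 * P.eval (z i) /
          (P.derivative.eval (z i) +
            P.derivative.eval (z i - Wi / (1 - P.eval (z i - Wi) / P.eval (z i)))) -
          r i‖ ≤ C * (⨆ j, ‖z j - r j‖) ^ 3 := by
  have step := fun i =>
    exists_cubic_bound_trapezoidal_newton
      (∏ j ∈ Finset.univ.erase i, (Polynomial.X - Polynomial.C (r j))) (r i)
      (by
        rw [Polynomial.eval_prod, Finset.prod_ne_zero_iff]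
        intro j hj
        simpa [sub_eq_zero] using fun h => Finset.ne_of_mem_erase hj (hr h).symm)
      (fun z : Fin n → ℂ => z i) (fun z => ∏ j ∈ Finset.univ.erase i, (z i - z j)) r
      (by fun_prop) (by fun_prop) rfl (by simp [Polynomial.eval_prod]) P
      (by rw [hP, Finset.mul_prod_erase _ (fun j => Polynomial.X - Polynomial.C (r j))
        (Finset.mem_univ i)])
  choose K hK hev using step
  obtain ⟨ε, hε, hball⟩ := Metric.eventually_nhds_iff.1 (Filter.eventually_all.2 hev)
  refine ⟨ε / 2, half_pos hε, ∑ i, K i,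
    Finset.sum_pos (fun i _ => hK i) ⟨⟨0, by omega⟩, Finset.mem_univ _⟩, ?_⟩
  intro z _ hz i W hW
  have hnorm : ‖z - r‖ ≤ ⨆ j, ‖z j - r j‖ :=
    (pi_norm_le_iff_of_nonneg (Real.iSup_nonneg fun _ => norm_nonneg _)).2 fun j =>
      le_ciSup (f := fun j => ‖z j - r j‖) (Set.finite_range _).bddAbove j
  have hdist : dist z r < ε := by
    rw [dist_eq_norm]
    refine lt_of_le_of_lt ?_ (half_lt_self hε)
    exact (pi_norm_le_iff_of_nonneg (half_pos hε).le).2 fun j => (hz j).2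
  obtain ⟨h₁, h₂, h₃, h₄⟩ := hball hdist i (sub_ne_zero.1 (norm_pos_iff.1 (hz i).1)) W hW
  refine ⟨h₁, h₂, h₃, h₄.trans ?_⟩
  gcongr
  · exact Finset.sum_nonneg fun j _ => (hK j).le
  · exact Finset.single_le_sum (fun j _ => (hK j).le) (Finset.mem_univ i)
end

section
/- (Theorem 3: Derivative-free midpoint Newton's method is of cubic order) Let n ≥ 2 and let P be a monic polynomial over ℂ of degree n whose roots r_1, …, r_n are pairwise distinct. Then there exist δ > 0 and C > 0 such that: for all pairwise distinct complex numbers z_1, …, z_n with 0 < |z_j − r_j| ≤ δ for every j, and every index i, setting W_i = P(z_i) / ∏_{j ≠ i} (z_i − z_j), one has P(z_i) ≠ 0, 1 − P(z_i − W_i)/P(z_i) ≠ 0, P'(z_i − (1/2)·W_i/(1 − P(z_i − W_i)/P(z_i))) ≠ 0, and the new approximation ẑ_i = z_i − P(z_i)/P'(z_i − (1/2)·W_i/(1 − P(z_i − W_i)/P(z_i))) satisfies |ẑ_i − r_i| ≤ C · (max_{1 ≤ j ≤ n} |z_j − r_j|)³. -/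
open Polynomial Filter Topology in
/-- One-dimensional core of the convergence proof: for `Q = X * q` with `q 0 ≠ 0`, one step of the
derivative-free midpoint Newton method started at `e`, with correction `e * (1 - h)`, is cubic
in `e`, uniformly for small `h`. -/
theorem exists_eventually_midpoint_newton_le (q : ℂ[X]) (hq : q.eval 0 ≠ 0) :
    ∃ C > 0, ∀ᶠ p : ℂ × ℂ in 𝓝 0, p.1 ≠ 0 → ∀ u : ℂ,
      u = 1 - (X * q).eval (p.1 - p.1 * (1 - p.2)) / (X * q).eval p.1 →
      (X * q).eval p.1 ≠ 0 ∧ u ≠ 0 ∧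
      (derivative (X * q)).eval (p.1 - (1 / 2) * (p.1 * (1 - p.2)) / u) ≠ 0 ∧
      ‖p.1 - (X * q).eval p.1 /
        (derivative (X * q)).eval (p.1 - (1 / 2) * (p.1 * (1 - p.2)) / u)‖ ≤ C * ‖p.1‖ ^ 3 := by
  set s := q.divX with hs
  set R := s.divX with hR
  have hqs (x : ℂ) : q.eval x = q.eval 0 + x * s.eval x := by
    conv_lhs => rw [← divX_mul_X_add q]
    simp [← hs, coeff_zero_eq_eval_zero]; ring
  have hsR (x : ℂ) : s.eval x = s.eval 0 + x * R.eval x := by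
    conv_lhs => rw [← divX_mul_X_add s]
    simp [← hR, coeff_zero_eq_eval_zero]; ring
  have hdq (x : ℂ) : (derivative q).eval x = s.eval x + x * (derivative s).eval x := by
    conv_lhs => rw [← divX_mul_X_add q]
    simp [← hs]; ring
  have hds (x : ℂ) : (derivative s).eval x = R.eval x + x * (derivative R).eval x := by
    conv_lhs => rw [← divX_mul_X_add s]
    simp [← hR]; ring
  set D : ℂ × ℂ → ℂ := fun p => q.eval p.1 - p.2 * q.eval (p.1 * p.2) with hD
  set κ : ℂ × ℂ → ℂ := fun p => p.2 * (s.eval p.1 - p.2 * s.eval (p.1 * p.2)) / D p with hκ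
  set t : ℂ × ℂ → ℂ := fun p => (1 + p.1 * κ p) / 2 with ht
  set E : ℂ × ℂ → ℂ := fun p => (derivative (X * q)).eval (p.1 * t p) with hE
  set F : ℂ × ℂ → ℂ := fun p =>
    (s.eval 0 * κ p + t p ^ 2 * (3 * R.eval (p.1 * t p) +
      p.1 * t p * (derivative R).eval (p.1 * t p)) - R.eval p.1) / E p with hF
  have cev (f : ℂ[X]) {g : ℂ × ℂ → ℂ} (hg : ContinuousAt g 0) :
      ContinuousAt (fun p => f.eval (g p)) 0 :=
    f.continuous.continuousAt.comp hg
  have c1 : ContinuousAt (fun p : ℂ × ℂ => p.1) 0 := continuousAt_fst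
  have c2 : ContinuousAt (fun p : ℂ × ℂ => p.2) 0 := continuousAt_snd
  have cD : ContinuousAt D 0 := (cev q c1).sub (c2.mul (cev q (c1.mul c2)))
  have hD0 : D 0 ≠ 0 := by simpa [hD] using hq
  have cκ : ContinuousAt κ 0 :=
    (c2.mul ((cev s c1).sub (c2.mul (cev s (c1.mul c2))))).div cD hD0
  have ct : ContinuousAt t 0 := (continuousAt_const.add (c1.mul cκ)).div_const 2
  have cE : ContinuousAt E 0 := cev _ (c1.mul ct)
  have hE0 : E 0 ≠ 0 := by simpa [hE, derivative_mul] using hq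
  have cF : ContinuousAt F 0 :=
    (((continuousAt_const.mul cκ).add ((ct.pow 2).mul
      ((continuousAt_const.mul (cev R (c1.mul ct))).add
        ((c1.mul ct).mul (cev _ (c1.mul ct)))))).sub (cev R c1)).div cE hE0
  refine ⟨‖F 0‖ + 1, by positivity, ?_⟩
  filter_upwards [cD.eventually_ne hD0, cE.eventually_ne hE0,
    (cev q c1).eventually_ne (by simpa using hq),
    cF.norm.eventually_lt_const (lt_add_one ‖F 0‖)] with p hDp hEp hqp hFp hp u hu
  have hu' : u = D p / q.eval p.1 := by
    have h1 : p.1 - p.1 * (1 - p.2) = p.1 * p.2 := by ring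
    rw [hu, h1]
    simp only [eval_mul, eval_X, hD]
    field_simp
  have hu0 : u ≠ 0 := hu' ▸ div_ne_zero hDp hqp
  have hκD : κ p * D p = p.2 * (s.eval p.1 - p.2 * s.eval (p.1 * p.2)) :=
    div_mul_cancel₀ _ hDp
  have hy : p.1 - (1 / 2) * (p.1 * (1 - p.2)) / u = p.1 * t p := by
    have key : (1 - p.1 * κ p) * D p = (1 - p.2) * q.eval p.1 := by
      have : (1 - p.1 * κ p) * D p = D p - p.1 * (κ p * D p) := by ring
      rw [this, hκD]
      simp only [hD]
      rw [hqs p.1, hqs (p.1 * p.2)]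
      ring
    have : (1 / 2) * (p.1 * (1 - p.2)) / u = p.1 * (1 - p.1 * κ p) / 2 := by
      rw [div_eq_iff hu0, hu']
      field_simp
      linear_combination -key
    rw [this]
    simp only [ht]
    ring
  rw [hy]
  refine ⟨by simpa using ⟨hp, hqp⟩, hu0, hEp, ?_⟩
  have hfin : p.1 - (X * q).eval p.1 / (derivative (X * q)).eval (p.1 * t p) = F p * p.1 ^ 3 := by
    change p.1 - _ / E p = _
    have hEe : E p = q.eval 0 + 2 * s.eval 0 * (p.1 * t p) + (p.1 * t p) ^ 2 *
        (3 * R.eval (p.1 * t p) + p.1 * t p * (derivative R).eval (p.1 * t p)) := by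
      simp only [hE, derivative_mul, derivative_X, eval_add, eval_mul, eval_X, eval_one]
      rw [hdq, hds, hqs, hsR]
      ring
    have ht2 : 2 * t p = 1 + p.1 * κ p := by simp only [ht]; ring
    have hFE : F p * E p = s.eval 0 * κ p + t p ^ 2 * (3 * R.eval (p.1 * t p) +
      p.1 * t p * (derivative R).eval (p.1 * t p)) - R.eval p.1 := div_mul_cancel₀ _ hEp
    rw [sub_eq_iff_eq_add, ← sub_eq_iff_eq_add', eq_div_iff hEp]
    have : (p.1 - F p * p.1 ^ 3) * E p = p.1 * E p - p.1 ^ 3 * (F p * E p) := by ring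
    rw [this, hFE, hEe, eval_mul, eval_X, hqs p.1, hsR p.1]
    linear_combination p.1 ^ 2 * s.eval 0 * ht2
  rw [hfin, norm_mul, norm_pow]
  gcongr


/-- **Theorem 3.** The derivative-free midpoint Newton method
`ẑ_i = z_i − P(z_i)/P'(z_i − (1/2)·W_i/(1 − P(z_i − W_i)/P(z_i)))` is of cubic order: for
a monic `P` of degree `n ≥ 2` with pairwise distinct roots `r_j`, there are `δ > 0` and
`C > 0` such that for pairwise distinct `z_j` with `0 < |z_j − r_j| ≤ δ`, all denominators
are nonzero and `|ẑ_i − r_i| ≤ C · (max_j |z_j − r_j|)³`. -/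
theorem method3_cubic_order (n : ℕ) (hn : 2 ≤ n) (r : Fin n → ℂ)
    (hr : Function.Injective r) (P : Polynomial ℂ)
    (hP : P = ∏ j, (Polynomial.X - Polynomial.C (r j))) :
    ∃ δ > 0, ∃ C > 0, ∀ z : Fin n → ℂ, Function.Injective z →
      (∀ j, 0 < ‖z j - r j‖ ∧ ‖z j - r j‖ ≤ δ) → ∀ i : Fin n, ∀ Wi : ℂ,
      Wi = P.eval (z i) / ∏ j ∈ Finset.univ.erase i, (z i - z j) →
      P.eval (z i) ≠ 0 ∧
      1 - P.eval (z i - Wi) / P.eval (z i) ≠ 0 ∧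
      P.derivative.eval
        (z i - (1 / 2) * Wi / (1 - P.eval (z i - Wi) / P.eval (z i))) ≠ 0 ∧
      ‖z i - P.eval (z i) /
          P.derivative.eval
            (z i - (1 / 2) * Wi / (1 - P.eval (z i - Wi) / P.eval (z i))) -
          r i‖ ≤ C * (⨆ j, ‖z j - r j‖) ^ 3 := by
  classical
  have hne : Nonempty (Fin n) := ⟨⟨0, by omega⟩⟩
  have key : ∀ i : Fin n, ∃ C > 0, ∀ᶠ z in nhds r, z i - r i ≠ 0 →
      ∀ Wi : ℂ, Wi = P.eval (z i) / ∏ j ∈ Finset.univ.erase i, (z i - z j) →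
      P.eval (z i) ≠ 0 ∧
      1 - P.eval (z i - Wi) / P.eval (z i) ≠ 0 ∧
      P.derivative.eval
        (z i - (1 / 2) * Wi / (1 - P.eval (z i - Wi) / P.eval (z i))) ≠ 0 ∧
      ‖z i - P.eval (z i) /
          P.derivative.eval
            (z i - (1 / 2) * Wi / (1 - P.eval (z i - Wi) / P.eval (z i))) -
          r i‖ ≤ C * ‖z i - r i‖ ^ 3 := by
    intro i
    set q : Polynomial ℂ :=
      ∏ j ∈ Finset.univ.erase i, (Polynomial.X + Polynomial.C (r i - r j)) with hq
    have hqe (x : ℂ) : q.eval x = ∏ j ∈ Finset.univ.erase i, (x + (r i - r j)) := by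
      simp [hq, Polynomial.eval_prod]
    have hprod : ∏ j ∈ Finset.univ.erase i, (r i - r j) ≠ 0 :=
      Finset.prod_ne_zero_iff.2 fun j hj =>
        sub_ne_zero.2 fun h => Finset.ne_of_mem_erase hj (hr h).symm
    have hPq : P = (Polynomial.X * q).comp (Polynomial.X - Polynomial.C (r i)) := by
      rw [hP, ← Finset.mul_prod_erase _ _ (Finset.mem_univ i), hq]
      simp [Polynomial.mul_comp, Polynomial.prod_comp]
    have hPe (x : ℂ) : P.eval x = (Polynomial.X * q).eval (x - r i) := by
      simp [hPq]
    have hPd (x : ℂ) : P.derivative.eval x = (Polynomial.X * q).derivative.eval (x - r i) := by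
      rw [hPq, Polynomial.derivative_comp]
      simp
    obtain ⟨C, hC, hev⟩ := exists_eventually_midpoint_newton_le q (by simpa [hqe] using hprod)
    refine ⟨C, hC, ?_⟩
    have cden : ContinuousAt (fun z : Fin n → ℂ => ∏ j ∈ Finset.univ.erase i, (z i - z j)) r :=
      Continuous.continuousAt (by fun_prop)
    have cnum : ContinuousAt (fun z : Fin n → ℂ => ∏ j ∈ Finset.univ.erase i, (z i - r j)) r :=
      Continuous.continuousAt (by fun_prop)
    have hlim : Filter.Tendsto (fun z : Fin n → ℂ => (z i - r i,
        1 - (∏ j ∈ Finset.univ.erase i, (z i - r j)) / ∏ j ∈ Finset.univ.erase i, (z i - z j)))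
        (nhds r) (nhds 0) := by
      have cfst : ContinuousAt (fun z : Fin n → ℂ => z i - r i) r :=
        Continuous.continuousAt (by fun_prop)
      have h := cfst.prodMk
        ((continuousAt_const (y := (1 : ℂ))).sub (cnum.div cden hprod))
      have h0 := h.tendsto
      rw [Prod.zero_eq_mk]
      simpa [div_self hprod] using h0
    filter_upwards [hlim.eventually hev] with z hz hzi Wi hWi
    have hW : Wi = (z i - r i) * (1 - (1 - (∏ j ∈ Finset.univ.erase i, (z i - r j)) /
        ∏ j ∈ Finset.univ.erase i, (z i - z j))) := by
      rw [hWi, hPe, Polynomial.eval_mul, Polynomial.eval_X, hqe]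
      simp only [sub_add_sub_cancel]
      ring
    have h := hz hzi _ rfl
    simp only [← hW] at h
    have hs (x : ℂ) : z i - x - r i = z i - r i - x := by ring
    simp only [hPe, hPd, hs]
    exact h
  choose C hC hev using key
  obtain ⟨ε, hε, hball⟩ := Metric.eventually_nhds_iff.1 (Filter.eventually_all.2 hev)
  refine ⟨ε / 2, by positivity, ∑ i, C i,
    Finset.sum_pos (fun i _ => hC i) Finset.univ_nonempty, ?_⟩
  intro z _ hz i Wi hWi
  have hdist : dist z r < ε := by
    refine (dist_pi_lt_iff hε).2 fun j => ?_
    rw [dist_eq_norm]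
    linarith [(hz j).2]
  obtain ⟨h1, h2, h3, h4⟩ := hball hdist i (norm_pos_iff.1 (hz i).1) Wi hWi
  refine ⟨h1, h2, h3, h4.trans ?_⟩
  gcongr
  · exact Finset.sum_nonneg fun i _ => (hC i).le
  · exact Finset.single_le_sum (fun i _ => (hC i).le) (Finset.mem_univ i)
  · exact le_ciSup (f := fun j => ‖z j - r j‖) (Set.finite_range _).bddAbove i
end

section
/- (Petković's derivative-free method is of cubic order) Let n ≥ 2 and let P be a monic polynomial over ℂ of degree n whose roots r_1, …, r_n are pairwise distinct. Then there exist δ > 0 and C > 0 such that: for all pairwise distinct complex numbers z_1, …, z_n with 0 < |z_j − r_j| ≤ δ for every j, and every index i, setting W_i = P(z_i) / ∏_{j ≠ i} (z_i − z_j), one has P(z_i) ≠ 0, 1 − P(z_i − W_i)/P(z_i) ≠ 0, and |z_i − W_i/(1 − P(z_i − W_i)/P(z_i)) − r_i| ≤ C · (max_{1 ≤ j ≤ n} |z_j − r_j|)³. -/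
open Topology in
/-- If `P = (X - r i) * Q` with `Q (r i) = ∏_{j ≠ i} (r i - r j) ≠ 0`, the error of one step of the
derivative-free method at index `i` is `O(‖z - r‖ ^ 3)` as `z → r`. -/
theorem eventually_derivative_free_error_le {ι : Type*} [Fintype ι] [DecidableEq ι] (r : ι → ℂ)
    (i : ι) (P Q : Polynomial ℂ) (hPQ : P = (Polynomial.X - Polynomial.C (r i)) * Q)
    (hQ : Q.eval (r i) = ∏ j ∈ Finset.univ.erase i, (r i - r j)) (hQ0 : Q.eval (r i) ≠ 0) :
    ∃ C : ℝ, ∀ᶠ z in 𝓝 r, z i ≠ r i → ∀ W : ℂ,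
      W = P.eval (z i) / ∏ j ∈ Finset.univ.erase i, (z i - z j) →
      P.eval (z i) ≠ 0 ∧ 1 - P.eval (z i - W) / P.eval (z i) ≠ 0 ∧
      ‖z i - W / (1 - P.eval (z i - W) / P.eval (z i)) - r i‖ ≤ C * ‖z - r‖ ^ 3 := by
  have heval (x : ℂ) : P.eval x = (x - r i) * Q.eval x := by simp [hPQ]
  set D : (ι → ℂ) → ℂ := fun z ↦ ∏ j ∈ Finset.univ.erase i, (z i - z j) with hD
  have hD0 : D r ≠ 0 := fun h ↦ hQ0 (hQ.trans h)
  have hDd : DifferentiableAt ℂ D r := by fun_prop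
  have hQd : DifferentiableAt ℂ (fun z : ι → ℂ ↦ Q.eval (z i)) r :=
    Q.differentiable.differentiableAt.comp r (differentiableAt_apply i r)
  have hPd : DifferentiableAt ℂ (fun z : ι → ℂ ↦ P.eval (z i)) r :=
    P.differentiable.differentiableAt.comp r (differentiableAt_apply i r)
  set A : (ι → ℂ) → ℂ := fun z ↦ Q.eval (z i) / D z with hA
  set B : (ι → ℂ) → ℂ := fun z ↦ Q.eval (z i - P.eval (z i) / D z) / Q.eval (z i) with hB
  have hAd : DifferentiableAt ℂ A r := by
    simpa only [hA, div_eq_mul_inv] using hQd.fun_mul (hDd.fun_inv hD0)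
  have hWd : DifferentiableAt ℂ (fun z : ι → ℂ ↦ P.eval (z i) / D z) r := by
    simpa only [div_eq_mul_inv] using hPd.fun_mul (hDd.fun_inv hD0)
  have hBd : DifferentiableAt ℂ B r := by
    have hcomp : DifferentiableAt ℂ (fun z : ι → ℂ ↦ Q.eval (z i - P.eval (z i) / D z)) r :=
      Q.differentiable.differentiableAt.comp r ((differentiableAt_apply i r).fun_sub hWd)
    simpa only [hB, div_eq_mul_inv] using hcomp.fun_mul (hQd.fun_inv hQ0)
  have hAr : A r = 1 := by
    have : Q.eval (r i) = D r := hQ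
    simp [hA, this, hD0]
  have hBr : B r = 1 := by simp [hB, heval, hQ0]
  obtain ⟨a, ha⟩ := hAd.isBigO_sub.bound
  obtain ⟨b, hb⟩ := hBd.isBigO_sub.bound
  have hden : ∀ᶠ z in 𝓝 r, 1 / 2 < ‖1 + (A z - 1) * B z‖ := by
    have hc : ContinuousAt (fun z ↦ ‖1 + (A z - 1) * B z‖) r :=
      (continuousAt_const.add
        ((hAd.continuousAt.sub continuousAt_const).mul hBd.continuousAt)).norm
    exact hc.eventually (lt_mem_nhds (by norm_num [hAr]))
  refine ⟨2 * a * b, ?_⟩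
  filter_upwards [ha, hb, hden, hQd.continuousAt.eventually_ne hQ0,
    hDd.continuousAt.eventually_ne hD0] with z ha hb hden hq hd he W hW
  have he' : z i - r i ≠ 0 := sub_ne_zero.2 he
  have hp : P.eval (z i) ≠ 0 := by rw [heval]; exact mul_ne_zero he' hq
  have hWA : W = (z i - r i) * A z := by rw [hW, heval, hA, mul_div_assoc]
  have hBW : B z = Q.eval (z i - W) / Q.eval (z i) := by rw [hW]
  have hstep : 1 - P.eval (z i - W) / P.eval (z i) = 1 + (A z - 1) * B z := by
    rw [heval, heval, hBW, show z i - W - r i = (z i - r i) * (1 - A z) by rw [hWA]; ring]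
    field_simp
    ring
  have hne : 1 + (A z - 1) * B z ≠ 0 := norm_pos_iff.1 (by linarith)
  refine ⟨hp, hstep ▸ hne, ?_⟩
  have herr : z i - W / (1 - P.eval (z i - W) / P.eval (z i)) - r i =
      (z i - r i) * (A z - 1) * (B z - 1) / (1 + (A z - 1) * B z) := by
    rw [hstep, hWA]
    field_simp
    ring
  rw [hAr] at ha
  rw [hBr] at hb
  have hi : ‖z i - r i‖ ≤ ‖z - r‖ := norm_le_pi_norm (z - r) i
  have hnum : ‖z i - r i‖ * ‖A z - 1‖ * ‖B z - 1‖ ≤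
      ‖z - r‖ * (a * ‖z - r‖) * (b * ‖z - r‖) :=
    mul_le_mul (mul_le_mul hi ha (norm_nonneg _) (norm_nonneg _)) hb (norm_nonneg _)
      (mul_nonneg (norm_nonneg _) ((norm_nonneg _).trans ha))
  have hnonneg := mul_nonneg (mul_nonneg (norm_nonneg (z i - r i)) (norm_nonneg (A z - 1)))
    (norm_nonneg (B z - 1))
  rw [herr, norm_div, norm_mul, norm_mul, div_le_iff₀ (by linarith)]
  nlinarith [mul_le_mul_of_nonneg_left hden.le (hnonneg.trans hnum)]

/-- Petković's derivative-free method
`ẑ_i = z_i − W_i/(1 − P(z_i − W_i)/P(z_i))` is of cubic order: for a monic `P` of degree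
`n ≥ 2` with pairwise distinct roots `r_j`, there are `δ > 0` and `C > 0` such that for
pairwise distinct `z_j` with `0 < |z_j − r_j| ≤ δ`, one has `P(z_i) ≠ 0`,
`1 − P(z_i − W_i)/P(z_i) ≠ 0`, and `|ẑ_i − r_i| ≤ C · (max_j |z_j − r_j|)³`. -/
theorem derivative_free_cubic_order (n : ℕ) (hn : 2 ≤ n) (r : Fin n → ℂ)
    (hr : Function.Injective r) (P : Polynomial ℂ)
    (hP : P = ∏ j, (Polynomial.X - Polynomial.C (r j))) :
    ∃ δ > 0, ∃ C > 0, ∀ z : Fin n → ℂ, Function.Injective z →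
      (∀ j, 0 < ‖z j - r j‖ ∧ ‖z j - r j‖ ≤ δ) → ∀ i : Fin n, ∀ Wi : ℂ,
      Wi = P.eval (z i) / ∏ j ∈ Finset.univ.erase i, (z i - z j) →
      P.eval (z i) ≠ 0 ∧
      1 - P.eval (z i - Wi) / P.eval (z i) ≠ 0 ∧
      ‖z i - Wi / (1 - P.eval (z i - Wi) / P.eval (z i)) - r i‖ ≤
        C * (⨆ j, ‖z j - r j‖) ^ 3 := by
  have hlocal (i : Fin n) := by
    refine eventually_derivative_free_error_le r i P
      (∏ j ∈ Finset.univ.erase i, (Polynomial.X - Polynomial.C (r j))) ?_ ?_ ?_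
    · rw [hP, Finset.mul_prod_erase _ (fun j ↦ Polynomial.X - Polynomial.C (r j))
        (Finset.mem_univ i)]
    · simp [Polynomial.eval_prod]
    · rw [Polynomial.eval_prod, Finset.prod_ne_zero_iff]
      intro j hj
      simpa [sub_eq_zero] using hr.ne (Finset.ne_of_mem_erase hj).symm
  choose C hC using hlocal
  obtain ⟨ε, hε, hball⟩ := Metric.eventually_nhds_iff.1 (Filter.eventually_all.2 hC)
  refine ⟨ε / 2, half_pos hε, 1 + ∑ i, |C i|, by positivity, fun z _ hz i W hW ↦ ?_⟩
  have hdist : dist z r < ε := by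
    refine ((dist_pi_le_iff (half_pos hε).le).2 fun j ↦ ?_).trans_lt (half_lt_self hε)
    exact dist_eq_norm (z j) (r j) ▸ (hz j).2
  obtain ⟨hp, hne, hle⟩ := hball hdist i (sub_ne_zero.1 (norm_pos_iff.1 (hz i).1)) W hW
  refine ⟨hp, hne, hle.trans ?_⟩
  have hsup : ‖z - r‖ ≤ ⨆ j, ‖z j - r j‖ :=
    (pi_norm_le_iff_of_nonneg (Real.iSup_nonneg fun _ ↦ norm_nonneg _)).2 fun j ↦
      le_ciSup (f := fun j ↦ ‖z j - r j‖) (Set.finite_range _).bddAbove j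
  have hCi : C i ≤ 1 + ∑ i, |C i| := by
    have := Finset.single_le_sum (f := fun i ↦ |C i|) (fun _ _ ↦ abs_nonneg _)
      (Finset.mem_univ i)
    linarith [le_abs_self (C i)]
  gcongr
end

section
/- (Petković's Newton–Weierstrass method is of cubic order) Let n ≥ 2 and let P be a monic polynomial over ℂ of degree n whose roots r_1, …, r_n are pairwise distinct. Then there exist δ > 0 and C > 0 such that: for all pairwise distinct complex numbers z_1, …, z_n with |z_j − r_j| ≤ δ for every j, and every index i, setting W_i = P(z_i) / ∏_{j ≠ i} (z_i − z_j), one has P'(z_i − W_i/2) ≠ 0 and |z_i − P(z_i)/P'(z_i − W_i/2) − r_i| ≤ C · (max_{1 ≤ j ≤ n} |z_j − r_j|)³. -/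
open Polynomial Filter Topology Asymptotics

/-- First-order Taylor expansion of a polynomial with polynomial remainder. -/
theorem Polynomial.exists_eval_eq_taylor_one {R : Type*} [CommRing R] (p : R[X]) (a : R) :
    ∃ q : R[X], ∀ x, p.eval x =
      p.eval a + (x - a) * p.derivative.eval a + (x - a) ^ 2 * q.eval x := by
  obtain ⟨q, hq⟩ := X_sub_C_dvd_sub_C_eval (p := p) (a := a)
  obtain ⟨s, hs⟩ := X_sub_C_dvd_sub_C_eval (p := q) (a := a)
  have hp : p = C (p.eval a) + (X - C a) * q := by rw [← hq]; ring
  have hd : p.derivative.eval a = q.eval a := by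
    conv_lhs => rw [hp]
    simp
  refine ⟨s, fun x => ?_⟩
  have h₁ := congrArg (eval x) hq
  have h₂ := congrArg (eval x) hs
  simp only [eval_sub, eval_mul, eval_X, eval_C] at h₁ h₂
  rw [hd]
  linear_combination h₁ + (x - a) * h₂

/-- The Weierstrass correction of `p` at the `i`-th approximation. -/
noncomputable def weierstrassCorrection {ι : Type*} [Fintype ι] [DecidableEq ι]
    (p : ℂ[X]) (z : ι → ℂ) (i : ι) : ℂ :=
  p.eval (z i) / ∏ j ∈ Finset.univ.erase i, (z i - z j)

theorem newton_weierstrass_isBigO {ι : Type*} [Fintype ι] [DecidableEq ι] {r : ι → ℂ}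
    (hr : Function.Injective r) {p : ℂ[X]} (hp : p = ∏ j, (X - C (r j))) (i : ι) :
    (∀ᶠ z in 𝓝 r, p.derivative.eval (z i - weierstrassCorrection p z i / 2) ≠ 0) ∧
      (fun z : ι → ℂ => z i - p.eval (z i) /
          p.derivative.eval (z i - weierstrassCorrection p z i / 2) - r i)
        =O[𝓝 r] fun z => ‖z - r‖ ^ 3 := by
  set q : ℂ[X] := ∏ j ∈ Finset.univ.erase i, (X - C (r j)) with hq
  have hpq : p = (X - C (r i)) * q := by
    rw [hp, hq, Finset.mul_prod_erase Finset.univ (fun j => X - C (r j)) (Finset.mem_univ i)]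
  have hqr : q.eval (r i) ≠ 0 := by
    rw [hq, eval_prod, Finset.prod_ne_zero_iff]
    intro j hj
    simpa [sub_eq_zero] using fun h => (Finset.ne_of_mem_erase hj) (hr h).symm
  have hd : p.derivative.eval (r i) = q.eval (r i) := by simp [hpq]
  have hdd : p.derivative.derivative.eval (r i) = 2 * q.derivative.eval (r i) := by
    simp [hpq]; ring
  obtain ⟨A, hA⟩ := q.exists_eval_eq_taylor_one (r i)
  obtain ⟨B, hB⟩ := p.derivative.exists_eval_eq_taylor_one (r i)
  rw [hd, hdd] at hB
  let h : (ι → ℂ) → ℂ := fun z => q.eval (z i) / ∏ j ∈ Finset.univ.erase i, (z i - z j)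
  let w : (ι → ℂ) → ℂ := fun z => z i - weierstrassCorrection p z i / 2
  have hD : ∏ j ∈ Finset.univ.erase i, (r i - r j) = q.eval (r i) := by simp [hq, eval_prod]
  have hhr : h r = 1 := by simp only [h, hD]; exact div_self hqr
  have hdiff : DifferentiableAt ℂ h r := by
    have hnum : DifferentiableAt ℂ (fun z : ι → ℂ => q.eval (z i)) r :=
      q.differentiableAt.comp r (differentiableAt_apply i r)
    have hden : DifferentiableAt ℂ
        (fun z : ι → ℂ => ∏ j ∈ Finset.univ.erase i, (z i - z j)) r := by
      fun_prop
    simp only [h, div_eq_mul_inv]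
    exact hnum.mul (hden.fun_inv (by rwa [hD]))
  have hW : ∀ z, weierstrassCorrection p z i = (z i - r i) * h z := fun z => by
    simp [weierstrassCorrection, h, hpq, mul_div_assoc]
  have hcoord : (fun z : ι → ℂ => z i - r i) =O[𝓝 r] fun z => ‖z - r‖ :=
    .of_bound 1 (.of_forall fun z => by simpa using norm_le_pi_norm (z - r) i)
  have hh : (fun z => h z - 1) =O[𝓝 r] fun z => ‖z - r‖ := by
    simpa [hhr] using hdiff.isBigO_sub.norm_right
  have hwcont : ContinuousAt w r := by
    have := hdiff.continuousAt
    have hi : ContinuousAt (fun z : ι → ℂ => z i) r := (continuous_apply i).continuousAt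
    simp only [w, hW]
    exact hi.sub (((hi.sub continuousAt_const).mul this).div_const 2)
  have hwr : w r = r i := by simp [w, hW]
  have hw : (fun z => w z - r i) =O[𝓝 r] fun z => ‖z - r‖ := by
    have h1 : (fun z => 1 - h z / 2) =O[𝓝 r] fun _ => (1 : ℝ) :=
      (continuousAt_const.sub (hdiff.continuousAt.div_const 2)).norm.isBoundedUnder_le.isBigO_one ℝ
    refine (hcoord.mul h1).congr (fun z => ?_) (fun z => mul_one _)
    simp only [w, hW]; ring
  have hder : ContinuousAt (fun z => p.derivative.eval (w z)) r :=
    p.derivative.continuous.continuousAt.comp hwcont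
  have hder0 : p.derivative.eval (w r) ≠ 0 := by rwa [hwr, hd]
  have hne := hder.eventually_ne hder0
  refine ⟨hne, ?_⟩
  have hAb : (fun z : ι → ℂ => A.eval (z i)) =O[𝓝 r] fun _ => (1 : ℝ) :=
    (A.continuous.comp (continuous_apply i)).continuousAt.norm.isBoundedUnder_le.isBigO_one ℝ
  have hBb : (fun z => B.eval (w z)) =O[𝓝 r] fun _ => (1 : ℝ) :=
    (B.continuous.continuousAt.comp hwcont).norm.isBoundedUnder_le.isBigO_one ℝ
  have hinv : (fun z => (p.derivative.eval (w z))⁻¹) =O[𝓝 r] fun _ => (1 : ℝ) :=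
    (hder.inv₀ hder0).norm.isBoundedUnder_le.isBigO_one ℝ
  have hnum : (fun z => p.derivative.eval (w z) - q.eval (z i)) =O[𝓝 r]
      fun z => ‖z - r‖ ^ 2 := by
    have t1 := (hcoord.mul hh).const_mul_left (-q.derivative.eval (r i))
    have t2 := (hw.pow 2).mul hBb
    have t3 := (hcoord.pow 2).mul hAb
    simp only [mul_one, ← pow_two] at t1 t2 t3
    refine ((t1.add t2).sub t3).congr_left fun z => ?_
    rw [hA (z i), hB (w z)]
    have : w z - r i = (z i - r i) - (z i - r i) * h z / 2 := by simp only [w, hW]; ring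
    linear_combination (-2 * q.derivative.eval (r i)) * this
  refine ((hcoord.mul hnum).mul hinv).congr' ?_ (.of_forall fun z => by ring)
  filter_upwards [hne] with z hz
  have hpz : p.eval (z i) = (z i - r i) * q.eval (z i) := by simp [hpq]
  change _ = z i - p.eval (z i) / p.derivative.eval (w z) - r i
  rw [hpz]
  field_simp
  ring


/-- Petković's Newton–Weierstrass method
`ẑ_i = z_i − P(z_i)/P'(z_i − W_i/2)` is of cubic order: for a monic `P` of degree `n ≥ 2`
with pairwise distinct roots `r_j`, there are `δ > 0` and `C > 0` such that for pairwise
distinct `z_j` with `|z_j − r_j| ≤ δ`, one has `P'(z_i − W_i/2) ≠ 0` and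
`|ẑ_i − r_i| ≤ C · (max_j |z_j − r_j|)³`. -/
theorem newton_weierstrass_cubic_order (n : ℕ) (hn : 2 ≤ n) (r : Fin n → ℂ)
    (hr : Function.Injective r) (P : Polynomial ℂ)
    (hP : P = ∏ j, (Polynomial.X - Polynomial.C (r j))) :
    ∃ δ > 0, ∃ C > 0, ∀ z : Fin n → ℂ, Function.Injective z →
      (∀ j, ‖z j - r j‖ ≤ δ) → ∀ i : Fin n, ∀ Wi : ℂ,
      Wi = P.eval (z i) / ∏ j ∈ Finset.univ.erase i, (z i - z j) →
      P.derivative.eval (z i - Wi / 2) ≠ 0 ∧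
      ‖z i - P.eval (z i) / P.derivative.eval (z i - Wi / 2) - r i‖ ≤
        C * (⨆ j, ‖z j - r j‖) ^ 3 := by
  choose hne hO using newton_weierstrass_isBigO hr hP
  choose c hc hbound using fun i => (hO i).exists_pos
  have hev := (eventually_all.2 hne).and (eventually_all.2 fun i => (hbound i).bound)
  obtain ⟨ε, hε, hball⟩ := Metric.eventually_nhds_iff.1 hev
  have hi₀ : Nonempty (Fin n) := ⟨⟨0, by omega⟩⟩
  refine ⟨ε / 2, half_pos hε, ∑ i, c i, Finset.sum_pos (fun i _ => hc i) Finset.univ_nonempty, ?_⟩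
  rintro z - hz i _ rfl
  have hdist : dist z r < ε := by
    rw [dist_eq_norm]
    exact ((pi_norm_le_iff_of_nonneg (half_pos hε).le).2 hz).trans_lt (half_lt_self hε)
  obtain ⟨h₁, h₂⟩ := hball hdist
  refine ⟨h₁ i, (h₂ i).trans ?_⟩
  have hsup : ‖z - r‖ ≤ ⨆ j, ‖z j - r j‖ :=
    (pi_norm_le_iff_of_nonempty _).2 fun j =>
      le_ciSup (f := fun j => ‖z j - r j‖) (Set.finite_range _).bddAbove j
  rw [norm_pow, norm_norm]
  gcongr
  · exact Finset.sum_nonneg fun i _ => (hc i).le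
  · exact Finset.single_le_sum (fun i _ => (hc i).le) (Finset.mem_univ i)
end

section
/- (Trapezoidal Newton's method is of cubic order) Let f : ℝ → ℝ be three times continuously differentiable on a neighborhood of a point r with f(r) = 0 and f'(r) ≠ 0. Then there exist δ > 0 and C > 0 such that for all x with |x − r| ≤ δ, one has f'(x) ≠ 0, and setting x* = x − f(x)/f'(x), one has f'(x) + f'(x*) ≠ 0 and the trapezoidal Newton iterate x̂ = x − 2·f(x)/(f'(x) + f'(x*)) satisfies |x̂ − r| ≤ C · |x − r|³. -/
open Asymptotics Filter Topology in
/-- If `g r = 0` and `g' = O((x - r) ^ n)` near `r`, then `g = O((x - r) ^ (n + 1))`. -/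
theorem isBigO_pow_succ_of_deriv_isBigO_pow {g g' : ℝ → ℝ} {r : ℝ} {n : ℕ}
    (hg : ∀ᶠ x in 𝓝 r, HasDerivAt g (g' x) x) (h0 : g r = 0)
    (h : g' =O[𝓝 r] fun x => (x - r) ^ n) :
    g =O[𝓝 r] fun x => (x - r) ^ (n + 1) := by
  obtain ⟨C, hC, hb⟩ := h.exists_pos
  obtain ⟨ε, hε, H⟩ := Metric.eventually_nhds_iff_ball.1 (hg.and hb.bound)
  refine IsBigO.of_bound C ?_
  filter_upwards [Metric.ball_mem_nhds r hε] with x hx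
  have hsub : ∀ y ∈ Metric.closedBall r ‖x - r‖, y ∈ Metric.ball r ε := by
    intro y hy
    rw [Metric.mem_ball, Real.dist_eq] at hx
    exact (Metric.mem_closedBall.1 hy).trans_lt hx
  have := (convex_closedBall r ‖x - r‖).norm_image_sub_le_of_norm_hasDerivWithin_le
    (f := g) (f' := g') (C := C * ‖x - r‖ ^ n) (x := r) (y := x)
    (fun y hy => (H y (hsub y hy)).1.hasDerivWithinAt)
    (fun y hy => by
      refine (H y (hsub y hy)).2.trans ?_
      rw [norm_pow]
      rw [Metric.mem_closedBall, dist_eq_norm] at hy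
      gcongr)
    (by simp) (by simp [dist_eq_norm])
  rw [h0, sub_zero] at this
  rw [norm_pow, pow_succ, ← mul_assoc]
  exact this

open Asymptotics Filter Topology in
/-- The trapezoidal Newton step is well defined near a simple root `r`, with error
`O((x - r) ^ 3)`. -/
theorem trapezoidal_newton_eventually_ne_and_isBigO (f : ℝ → ℝ) (r : ℝ)
    (hf : ContDiffAt ℝ 3 f r) (hr : f r = 0) (hr' : deriv f r ≠ 0) :
    (∀ᶠ x in 𝓝 r, deriv f x ≠ 0) ∧
    (∀ᶠ x in 𝓝 r, deriv f x + deriv f (x - f x / deriv f x) ≠ 0) ∧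
    (fun x => x - 2 * f x / (deriv f x + deriv f (x - f x / deriv f x)) - r)
      =O[𝓝 r] fun x => (x - r) ^ 3 := by
  have hg : ContDiffAt ℝ 2 (deriv f) r := hf.derivWithin (by norm_num)
  have hh : ContDiffAt ℝ 1 (deriv (deriv f)) r := hg.derivWithin (by norm_num)
  have hf' : ∀ᶠ x in 𝓝 r, HasDerivAt f (deriv f x) x :=
    (hf.eventually (by simp)).mono fun x hx => (hx.differentiableAt (by simp)).hasDerivAt
  have hg' : ∀ᶠ x in 𝓝 r, HasDerivAt (deriv f) (deriv (deriv f) x) x :=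
    (hg.eventually (by simp)).mono fun x hx => (hx.differentiableAt (by simp)).hasDerivAt
  have hne : ∀ᶠ x in 𝓝 r, deriv f x ≠ 0 := hg.continuousAt.eventually_ne hr'
  set a := deriv f r with ha
  set c := deriv (deriv f) r
  have h2 : (fun x => deriv (deriv f) x - c) =O[𝓝 r] fun x => (x - r) ^ 1 := by
    simpa using (hh.differentiableAt (by simp)).isBigO_sub
  have h1 : (fun x => deriv f x - a - c * (x - r)) =O[𝓝 r] fun x => (x - r) ^ 2 := by
    refine isBigO_pow_succ_of_deriv_isBigO_pow ?_ (by simp [ha]) h2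
    filter_upwards [hg'] with x hx
    exact ((hx.sub_const a).sub (((hasDerivAt_id x).sub_const r).const_mul c)).congr_deriv
      (by simp)
  have h0 : (fun x => f x - a * (x - r) - c / 2 * (x - r) ^ 2)
      =O[𝓝 r] fun x => (x - r) ^ 3 := by
    refine isBigO_pow_succ_of_deriv_isBigO_pow ?_ (by simp [hr]) h1
    filter_upwards [hf'] with x hx
    refine ((hx.sub (((hasDerivAt_id x).sub_const r).const_mul a)).sub
      ((((hasDerivAt_id x).sub_const r).pow 2).const_mul (c / 2))).congr_deriv ?_
    simp
    ring
  have g1 : (fun x => deriv f x - a) =O[𝓝 r] fun x => x - r :=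
    (hg.differentiableAt (by simp)).isBigO_sub
  have f2 : (fun x => f x - a * (x - r)) =O[𝓝 r] fun x => (x - r) ^ 2 := by
    refine isBigO_pow_succ_of_deriv_isBigO_pow (g' := fun x => deriv f x - a) ?_
      (by simp [hr]) (by simpa using g1)
    filter_upwards [hf'] with x hx
    exact (hx.sub (((hasDerivAt_id x).sub_const r).const_mul a)).congr_deriv (by simp)
  have hinv : (fun x => (deriv f x)⁻¹) =O[𝓝 r] fun _ => (1 : ℝ) :=
    (hg.continuousAt.tendsto.inv₀ hr').isBigO_one ℝ
  have hy : (fun x => x - f x / deriv f x - r) =O[𝓝 r] fun x => (x - r) ^ 2 := by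
    have hnum : (fun x => (x - r) * (deriv f x - a) - (f x - a * (x - r)))
        =O[𝓝 r] fun x => (x - r) ^ 2 := by
      refine IsBigO.sub ?_ f2
      simpa only [sq] using (isBigO_refl (fun x => x - r) (𝓝 r)).mul g1
    refine (hnum.mul hinv).congr' ?_ (by simp)
    filter_upwards [hne] with x hx
    field_simp
    ring
  have hyt : Tendsto (fun x => x - f x / deriv f x) (𝓝 r) (𝓝 r) := by
    have : Tendsto (fun x : ℝ => (x - r) ^ 2) (𝓝 r) (𝓝 0) := by
      have h : Continuous fun x : ℝ => (x - r) ^ 2 := by fun_prop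
      simpa using h.tendsto r
    simpa using (hy.trans_tendsto this).add_const r
  have gy : (fun x => deriv f (x - f x / deriv f x) - a) =O[𝓝 r] fun x => (x - r) ^ 2 :=
    (g1.comp_tendsto hyt).trans hy
  have hden : Tendsto (fun x => deriv f x + deriv f (x - f x / deriv f x)) (𝓝 r)
      (𝓝 (a + a)) :=
    hg.continuousAt.tendsto.add (hg.continuousAt.tendsto.comp hyt)
  have haa : a + a ≠ 0 := by simpa using hr'
  have hdne := hden.eventually_ne haa
  refine ⟨hne, hdne, ?_⟩
  have hnum : (fun x => (x - r) * (deriv f x - a - c * (x - r))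
      + (x - r) * (deriv f (x - f x / deriv f x) - a)
      - 2 * (f x - a * (x - r) - c / 2 * (x - r) ^ 2)) =O[𝓝 r] fun x => (x - r) ^ 3 := by
    refine IsBigO.sub (IsBigO.add ?_ ?_) (h0.const_mul_left 2)
    · simpa only [pow_succ' _ 2] using (isBigO_refl (fun x => x - r) (𝓝 r)).mul h1
    · simpa only [pow_succ' _ 2] using (isBigO_refl (fun x => x - r) (𝓝 r)).mul gy
  refine (hnum.mul ((hden.inv₀ haa).isBigO_one ℝ)).congr' ?_ (by simp)
  filter_upwards [hdne] with x hx
  generalize deriv f (x - f x / deriv f x) = w at hx ⊢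
  field_simp
  ring


/-- The trapezoidal Newton method
`x̂ = x − 2f(x)/(f'(x) + f'(x*))`, `x* = x − f(x)/f'(x)`, is of cubic order at a simple
root `r` of a function `f : ℝ → ℝ` that is three times continuously differentiable on a
neighborhood of `r`. -/
theorem trapezoidal_newton_cubic_order (f : ℝ → ℝ) (r : ℝ) (U : Set ℝ)
    (hU : U ∈ nhds r) (hf : ContDiffOn ℝ 3 f U) (hr : f r = 0) (hr' : deriv f r ≠ 0) :
    ∃ δ > 0, ∃ C > 0, ∀ x : ℝ, |x - r| ≤ δ →
      deriv f x ≠ 0 ∧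
      deriv f x + deriv f (x - f x / deriv f x) ≠ 0 ∧
      |x - 2 * f x / (deriv f x + deriv f (x - f x / deriv f x)) - r| ≤
        C * |x - r| ^ 3 := by
  obtain ⟨h1, h2, h3⟩ :=
    trapezoidal_newton_eventually_ne_and_isBigO f r (hf.contDiffAt hU) hr hr'
  obtain ⟨C, hC, hb⟩ := h3.exists_pos
  obtain ⟨δ, hδ, H⟩ :=
    Metric.nhds_basis_closedBall.eventually_iff.1 (h1.and (h2.and hb.bound))
  refine ⟨δ, hδ, C, hC, fun x hx => ?_⟩
  obtain ⟨k1, k2, k3⟩ := H (x := x) (by simpa [Real.dist_eq] using hx)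
  exact ⟨k1, k2, by simpa only [Real.norm_eq_abs, abs_pow] using k3⟩
end

section
/- (Midpoint Newton's method is of cubic order) Let f : ℝ → ℝ be three times continuously differentiable on a neighborhood of a point r with f(r) = 0 and f'(r) ≠ 0. Then there exist δ > 0 and C > 0 such that for all x with |x − r| ≤ δ, one has f'(x) ≠ 0, and setting x* = x − f(x)/f'(x), one has f'(x + (x* − x)/2) ≠ 0 and the midpoint Newton iterate x̂ = x − f(x)/f'(x + (x* − x)/2) satisfies |x̂ − r| ≤ C · |x − r|³. -/
open Metric in
/-- On a ball, a bound `K * |y - r| ^ n` on the derivative of a function vanishing at the center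
gives the bound `K * |y - r| ^ (n + 1)` on the function. -/
theorem abs_le_pow_succ_of_hasDerivAt_ball {F F' : ℝ → ℝ} {r ε K : ℝ} {n : ℕ} (hK : 0 ≤ K)
    (hF : ∀ y ∈ ball r ε, HasDerivAt F (F' y) y) (h0 : F r = 0)
    (hF' : ∀ y ∈ ball r ε, |F' y| ≤ K * |y - r| ^ n) {y : ℝ} (hy : y ∈ ball r ε) :
    |F y| ≤ K * |y - r| ^ (n + 1) := by
  have hsub : closedBall r |y - r| ⊆ ball r ε :=
    closedBall_subset_ball (by simpa [Real.dist_eq] using hy)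
  have h := (convex_closedBall r |y - r|).norm_image_sub_le_of_norm_hasDerivWithin_le
    (f := F) (f' := F') (C := K * |y - r| ^ n) (x := r) (y := y)
    (fun z hz => (hF z (hsub hz)).hasDerivWithinAt)
    (fun z hz => (hF' z (hsub hz)).trans (by
      rw [mem_closedBall, Real.dist_eq] at hz
      gcongr))
    (mem_closedBall_self (abs_nonneg _)) (by simp [Real.dist_eq])
  simpa [h0, pow_succ, mul_assoc] using h

/-- Second order Taylor expansion at `r` of a `C³` function, and the first order expansion of its
derivative, with a common error constant. -/
theorem ContDiffAt.exists_taylor_bounds_two {f : ℝ → ℝ} {r : ℝ} (hf : ContDiffAt ℝ 3 f r) :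
    ∃ b K ε : ℝ, 0 < K ∧ 0 < ε ∧ ∀ y ∈ Metric.ball r ε,
      |deriv f y - deriv f r - b * (y - r)| ≤ K * |y - r| ^ 2 ∧
      |f y - f r - deriv f r * (y - r) - b / 2 * (y - r) ^ 2| ≤ K * |y - r| ^ 3 := by
  have hg : ContDiffAt ℝ 2 (deriv f) r := hf.derivWithin (by norm_num)
  have hg' : ContDiffAt ℝ 1 (deriv (deriv f)) r := hg.derivWithin (by norm_num)
  obtain ⟨K, hK, hbound⟩ := (hg'.differentiableAt (by norm_num)).isBigO_sub.exists_pos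
  have hfd : ∀ᶠ y in nhds r, DifferentiableAt ℝ f y :=
    (hf.eventually (by simp)).mono fun y hy => hy.differentiableAt (by norm_num)
  have hgd : ∀ᶠ y in nhds r, DifferentiableAt ℝ (deriv f) y :=
    (hg.eventually (by simp)).mono fun y hy => hy.differentiableAt (by norm_num)
  obtain ⟨ε, hε, h⟩ := Metric.eventually_nhds_iff_ball.1 (hfd.and (hgd.and hbound.bound))
  set b := deriv (deriv f) r
  have h1 : ∀ y ∈ Metric.ball r ε,
      |deriv f y - deriv f r - b * (y - r)| ≤ K * |y - r| ^ 2 := fun y hy =>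
    abs_le_pow_succ_of_hasDerivAt_ball (F := fun y => deriv f y - deriv f r - b * (y - r))
      (F' := fun y => deriv (deriv f) y - b) (n := 1) hK.le
      (fun z hz => by
        simpa using! ((h z hz).2.1.hasDerivAt.sub_const (deriv f r)).sub
          (((hasDerivAt_id z).sub_const r).const_mul b))
      (by simp) (fun z hz => by simpa using (h z hz).2.2) hy
  refine ⟨b, K, ε, hK, hε, fun y hy => ⟨h1 y hy, ?_⟩⟩
  exact abs_le_pow_succ_of_hasDerivAt_ball
    (F := fun y => f y - f r - deriv f r * (y - r) - b / 2 * (y - r) ^ 2)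
    (F' := fun y => deriv f y - deriv f r - b * (y - r)) (n := 2) hK.le
    (fun z hz => by
      refine HasDerivAt.congr_deriv (((h z hz).1.hasDerivAt.sub_const (f r)).sub
        (((hasDerivAt_id z).sub_const r).const_mul (deriv f r)) |>.sub
        ((((hasDerivAt_id z).sub_const r).pow 2).const_mul (b / 2))) ?_
      simp only [id_eq]
      ring)
    (by simp) h1 hy

/-- The midpoint Newton method
`x̂ = x − f(x)/f'(x + (x* − x)/2)`, `x* = x − f(x)/f'(x)`, is of cubic order at a simple
root `r` of a function `f : ℝ → ℝ` that is three times continuously differentiable on a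
neighborhood of `r`. -/
theorem midpoint_newton_cubic_order (f : ℝ → ℝ) (r : ℝ) (U : Set ℝ)
    (hU : U ∈ nhds r) (hf : ContDiffOn ℝ 3 f U) (hr : f r = 0) (hr' : deriv f r ≠ 0) :
    ∃ δ > 0, ∃ C > 0, ∀ x : ℝ, |x - r| ≤ δ →
      deriv f x ≠ 0 ∧
      deriv f (x + (x - f x / deriv f x - x) / 2) ≠ 0 ∧
      |x - f x / deriv f (x + (x - f x / deriv f x - x) / 2) - r| ≤
        C * |x - r| ^ 3 := by
  have hfr : ContDiffAt ℝ 3 f r := hf.contDiffAt hU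
  obtain ⟨b, K, ε, hK, hε, hT⟩ := hfr.exists_taylor_bounds_two
  set a := deriv f r
  have ha : 0 < |a| := abs_pos.2 hr'
  have hcont : ContinuousAt (deriv f) r := (hfr.derivWithin (m := 2) (by norm_num)).continuousAt
  obtain ⟨ρ, hρ, hlow⟩ := Metric.eventually_nhds_iff_ball.1
    (hcont.abs.eventually_const_lt (half_lt_self ha))
  set m := |a| / 2
  have hm : 0 < m := half_pos ha
  set M := |b| / 2 + 2 * K
  have hM : 0 < M := by positivity
  set δ := min (min (ε / 2) (ρ / 2)) (min 1 (m / M))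
  have hδ : 0 < δ := by positivity
  refine ⟨δ, hδ, (|b| * (M / m) / 2 + 2 * K) / m, by positivity, fun x hx => ?_⟩
  have hδε : δ < ε := by
    have : δ ≤ ε / 2 := (min_le_left _ _).trans (min_le_left _ _)
    linarith
  have hδρ : δ < ρ := by
    have : δ ≤ ρ / 2 := (min_le_left _ _).trans (min_le_right _ _)
    linarith
  have hx1 : |x - r| ≤ 1 := hx.trans ((min_le_right _ _).trans (min_le_left _ _))
  have hxM : |x - r| ≤ m / M := hx.trans ((min_le_right _ _).trans (min_le_right _ _))
  have hlow' : ∀ y, |y - r| ≤ δ → m < |deriv f y| := fun y hy =>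
    hlow y (by rw [Metric.mem_ball, Real.dist_eq]; linarith)
  have hT' : ∀ y, |y - r| ≤ δ → _ := fun y hy =>
    hT y (by rw [Metric.mem_ball, Real.dist_eq]; linarith)
  have hgx := hlow' x hx
  have hgx0 : deriv f x ≠ 0 := abs_pos.1 (hm.trans hgx)
  obtain ⟨hx2, hx3⟩ := hT' x hx
  rw [hr, sub_zero] at hx3
  set h := x - r with hh
  -- The error of the Newton step is quadratic.
  set e := x - f x / deriv f x - r with he
  have hee : e = (h * (deriv f x - a - b * h) - (f x - a * h - b / 2 * h ^ 2) + b / 2 * h ^ 2)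
      / deriv f x := by
    rw [he, eq_div_iff hgx0, hh]
    field_simp
    ring
  have hnum : |h * (deriv f x - a - b * h) - (f x - a * h - b / 2 * h ^ 2) + b / 2 * h ^ 2|
      ≤ M * |h| ^ 2 := by
    calc _ ≤ |h| * |deriv f x - a - b * h| + |f x - a * h - b / 2 * h ^ 2|
          + |b| / 2 * |h| ^ 2 := by
          refine (abs_add_le _ _).trans (add_le_add ((abs_sub _ _).trans_eq ?_) ?_)
          · rw [abs_mul]
          · simp [abs_mul, abs_div]
      _ ≤ |h| * (K * |h| ^ 2) + K * |h| ^ 3 + |b| / 2 * |h| ^ 2 := by gcongr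
      _ = (|b| / 2 + 2 * K * |h|) * |h| ^ 2 := by ring
      _ ≤ (|b| / 2 + 2 * K * 1) * |h| ^ 2 := by gcongr
      _ = M * |h| ^ 2 := by rw [mul_one]
  have he2 : |e| ≤ M / m * |h| ^ 2 := by
    rw [hee, abs_div]
    exact (div_le_div₀ (by positivity) hnum hm hgx.le).trans_eq (by ring)
  have heh : |e| ≤ |h| := by
    calc |e| ≤ M / m * |h| ^ 2 := he2
      _ = M / m * |h| * |h| := by ring
      _ ≤ M / m * (m / M) * |h| := by gcongr
      _ = |h| := by field_simp
  -- The midpoint is no farther from the root than `x`.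
  set y := x + (x - f x / deriv f x - x) / 2 with hy
  have hyr : y - r = (h + e) / 2 := by rw [hy, hh, he]; ring
  have hyh : |y - r| ≤ |h| := by
    rw [hyr, abs_div, abs_two]
    linarith [abs_add_le h e]
  have hgy := hlow' y (hyh.trans hx)
  have hgy0 : deriv f y ≠ 0 := abs_pos.1 (hm.trans hgy)
  have hy2 := (hT' y (hyh.trans hx)).1
  refine ⟨hgx0, hgy0, ?_⟩
  have hxhat : x - f x / deriv f y - r = (b / 2 * h * e + h * (deriv f y - a - b * (y - r))
      - (f x - a * h - b / 2 * h ^ 2)) / deriv f y := by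
    rw [eq_div_iff hgy0, hyr, sub_right_comm, ← hh, sub_mul, div_mul_cancel₀ _ hgy0]
    ring
  rw [hxhat, abs_div, div_mul_eq_mul_div (_ + _)]
  refine div_le_div₀ (by positivity) ?_ hm hgy.le
  calc _ ≤ |b| / 2 * |h| * |e| + |h| * |deriv f y - a - b * (y - r)|
        + |f x - a * h - b / 2 * h ^ 2| := by
        refine (abs_sub _ _).trans (add_le_add ((abs_add_le _ _).trans_eq ?_) le_rfl)
        simp [abs_mul, abs_div]
    _ ≤ |b| / 2 * |h| * (M / m * |h| ^ 2) + |h| * (K * |h| ^ 2) + K * |h| ^ 3 := by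
        gcongr
        exact hy2.trans (by gcongr)
    _ = (|b| * (M / m) / 2 + 2 * K) * |h| ^ 3 := by ring
end
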